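/- arXiv:2303.07659 — 10 statements merged into one kernel-verified Lean document; each statement's English description precedes it below -/
import Mathlib

section
/- Let N ≥ 5. Then ∫_{ℝ^N} |ΔV_ε(x)|² dx = ∫_{ℝ^N} |Δu_ε(x)|² dx + O(ε^{(N−4)/2}) as ε → 0⁺; that is, the function ε ↦ ∫_{ℝ^N} |ΔV_ε|² − ∫_{ℝ^N} |Δu_ε|² is big-O of ε^{(N−4)/2} in the right-neighborhood filter at 0. -/
open MeasureTheory Real Filter Asymptotics
open scoped Topology

/-- The Euclidean Laplacian: sum of second partial derivatives in the
coordinate directions. -/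
noncomputable def lapl {N : ℕ} (u : EuclideanSpace ℝ (Fin N) → ℝ)
    (x : EuclideanSpace ℝ (Fin N)) : ℝ :=
  ∑ i : Fin N, fderiv ℝ (fun y => fderiv ℝ u y (EuclideanSpace.single i 1)) x
    (EuclideanSpace.single i 1)

/-- The function `u_ε(x) = [N(N−4)(N²−4)ε²]^{(N−4)/8} / (ε + |x|²)^{(N−4)/2}`. -/
noncomputable def bubble (N : ℕ) (ε : ℝ) (x : EuclideanSpace ℝ (Fin N)) : ℝ :=
  ((N : ℝ) * ((N : ℝ) - 4) * ((N : ℝ) ^ 2 - 4) * ε ^ 2) ^ (((N : ℝ) - 4) / 8) /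
    (ε + ‖x‖ ^ 2) ^ (((N : ℝ) - 4) / 2)

/-- The truncated function `V_ε(x) = g(|x|) u_ε(x)`. -/
noncomputable def cutBubble (N : ℕ) (g : ℝ → ℝ) (ε : ℝ)
    (x : EuclideanSpace ℝ (Fin N)) : ℝ :=
  g ‖x‖ * bubble N ε x

theorem lapl_congr {N : ℕ} {u v : EuclideanSpace ℝ (Fin N) → ℝ} {x : EuclideanSpace ℝ (Fin N)}
    (h : u =ᶠ[𝓝 x] v) : lapl u x = lapl v x := by
  unfold lapl
  refine Finset.sum_congr rfl fun i _ => ?_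
  have h' : (fun y => fderiv ℝ u y (EuclideanSpace.single i 1)) =ᶠ[𝓝 x]
      fun y => fderiv ℝ v y (EuclideanSpace.single i 1) := by
    filter_upwards [h.fderiv (𝕜 := ℝ)] with y hy
    rw [hy]
  rw [h'.fderiv_eq]

theorem continuous_lapl {N : ℕ} {u : EuclideanSpace ℝ (Fin N) → ℝ} (hu : ContDiff ℝ 2 u) :
    Continuous (lapl u) := by
  unfold lapl
  refine continuous_finsetSum _ fun i _ => ?_
  have h1 : ContDiff ℝ 1 (fun y => fderiv ℝ u y (EuclideanSpace.single i 1)) :=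
    (hu.fderiv_right (m := 1) (by norm_num)).clm_apply contDiff_const
  exact (h1.continuous_fderiv one_ne_zero).clm_apply continuous_const

theorem lapl_comp_norm_sq {N : ℕ} {f f' : ℝ → ℝ} {f'' : ℝ} {x : EuclideanSpace ℝ (Fin N)}
    (hf : ∀ᶠ s in 𝓝 (‖x‖ ^ 2), HasDerivAt f (f' s) s) (hf' : HasDerivAt f' f'' (‖x‖ ^ 2)) :
    lapl (fun y => f (‖y‖ ^ 2)) x = 4 * ‖x‖ ^ 2 * f'' + 2 * N * f' (‖x‖ ^ 2) := by
  have hsq (y : EuclideanSpace ℝ (Fin N)) :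
      HasFDerivAt (fun y : EuclideanSpace ℝ (Fin N) => ‖y‖ ^ 2) (2 • innerSL ℝ y) y :=
    (hasStrictFDerivAt_norm_sq y).hasFDerivAt
  have hcont : Tendsto (fun y : EuclideanSpace ℝ (Fin N) => ‖y‖ ^ 2) (𝓝 x) (𝓝 (‖x‖ ^ 2)) :=
    (hsq x).continuousAt
  have hsecond (i : Fin N) :
      fderiv ℝ (fun y => fderiv ℝ (fun y : EuclideanSpace ℝ (Fin N) => f (‖y‖ ^ 2)) y
        (EuclideanSpace.single i 1)) x (EuclideanSpace.single i 1)
        = 4 * f'' * x i ^ 2 + 2 * f' (‖x‖ ^ 2) := by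
    have hfirst : (fun y => fderiv ℝ (fun y : EuclideanSpace ℝ (Fin N) => f (‖y‖ ^ 2)) y
        (EuclideanSpace.single i 1)) =ᶠ[𝓝 x] fun y => f' (‖y‖ ^ 2) * (2 * y i) := by
      filter_upwards [hcont.eventually hf] with y hy
      have h : HasFDerivAt (fun y : EuclideanSpace ℝ (Fin N) => f (‖y‖ ^ 2)) _ y :=
        hy.comp_hasFDerivAt y (hsq y)
      rw [h.fderiv (𝕜 := ℝ)]
      simp [EuclideanSpace.inner_single_right]
    have hcoord : HasFDerivAt (fun y : EuclideanSpace ℝ (Fin N) => y i)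
        (EuclideanSpace.proj i : EuclideanSpace ℝ (Fin N) →L[ℝ] ℝ) x :=
      (EuclideanSpace.proj i : EuclideanSpace ℝ (Fin N) →L[ℝ] ℝ).hasFDerivAt
    have h : HasFDerivAt (fun y : EuclideanSpace ℝ (Fin N) => f' (‖y‖ ^ 2) * (2 * y i)) _ x :=
      (hf'.comp_hasFDerivAt x (hsq x)).mul (hcoord.const_mul 2)
    rw [hfirst.fderiv_eq, h.fderiv]
    simp [EuclideanSpace.inner_single_right]
    ring
  unfold lapl
  rw [Finset.sum_congr rfl fun i _ => hsecond i, Finset.sum_add_distrib, ← Finset.mul_sum,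
    EuclideanSpace.real_norm_sq_eq]
  simp
  ring

theorem abs_lapl_radial_mul_rpow_le {N : ℕ} {k : ℝ → ℝ} (hk : ContDiffOn ℝ 2 k (Set.Ioi 0))
    {a A M ε : ℝ} (ha : 0 ≤ a) (hA : 0 ≤ A) (hε : 0 < ε) {x : EuclideanSpace ℝ (Fin N)}
    (hx : 0 < ‖x‖) (h0 : |k (‖x‖ ^ 2)| ≤ M) (h1 : |‖x‖ ^ 2 * deriv k (‖x‖ ^ 2)| ≤ M)
    (h2 : |(‖x‖ ^ 2) ^ 2 * deriv (deriv k) (‖x‖ ^ 2)| ≤ M) :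
    |lapl (fun y => k (‖y‖ ^ 2) * (A * (ε + ‖y‖ ^ 2) ^ (-a))) x| ≤
      A * ((4 * (1 + 2 * a + a * (a + 1)) + 2 * N * (1 + a)) * M) * (‖x‖ ^ 2) ^ (-a - 1) := by
  have hs : 0 < ‖x‖ ^ 2 := by positivity
  have hk1 {s : ℝ} (hs : 0 < s) : HasDerivAt k (deriv k s) s :=
    ((hk.contDiffAt (Ioi_mem_nhds hs)).differentiableAt (by norm_num)).hasDerivAt
  have hk2 {s : ℝ} (hs : 0 < s) : HasDerivAt (deriv k) (deriv (deriv k) s) s :=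
    (((hk.deriv_of_isOpen (m := 1) isOpen_Ioi (by norm_num)).contDiffAt
      (Ioi_mem_nhds hs)).differentiableAt (by norm_num)).hasDerivAt
  have hpow {s : ℝ} (hs : 0 < s) (b : ℝ) :
      HasDerivAt (fun t => (ε + t) ^ b) (b * (ε + s) ^ (b - 1)) s := by
    have h := ((hasDerivAt_id s).const_add ε).rpow_const (p := b) (Or.inl (by simp; positivity))
    simpa using h
  have key := lapl_comp_norm_sq (N := N) (x := x)
    (f := fun s => k s * (A * (ε + s) ^ (-a)))
    (f' := fun s => deriv k s * (A * (ε + s) ^ (-a)) + k s * (A * (-a * (ε + s) ^ (-a - 1))))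
    (by
      filter_upwards [Ioi_mem_nhds hs] with s hs
      exact (hk1 hs).mul ((hpow hs _).const_mul A))
    (((hk2 hs).mul ((hpow hs _).const_mul A)).add
      ((hk1 hs).mul (((hpow hs _).const_mul (-a)).const_mul A)))
  rw [key]
  generalize ‖x‖ ^ 2 = s at *
  have hq : 0 < ε + s := by positivity
  have e1 : (ε + s) ^ (-a - 1) = (ε + s) ^ (-a) / (ε + s) := rpow_sub_one hq.ne' _
  have e2 : (ε + s) ^ (-a - 1 - 1) = (ε + s) ^ (-a) / (ε + s) / (ε + s) := by
    rw [rpow_sub_one hq.ne', e1]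
  have hP : (ε + s) ^ (-a) ≤ s ^ (-a) :=
    rpow_le_rpow_of_nonpos hs (by linarith) (by linarith)
  have hP0 : 0 < (ε + s) ^ (-a) := rpow_pos_of_pos hq _
  rw [e1, e2, rpow_sub_one hs.ne']
  generalize (ε + s) ^ (-a) = P at *
  generalize s ^ (-a) = S at *
  generalize deriv (deriv k) s = k2 at *
  generalize deriv k s = k1 at *
  generalize k s = k0 at *
  have hM : 0 ≤ M := (abs_nonneg _).trans h0
  obtain ⟨t, ht⟩ : ∃ t, t = s / (ε + s) := ⟨_, rfl⟩
  have ht0 : 0 ≤ t := by rw [ht]; positivity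
  have ht1 : t ≤ 1 := by rw [ht, div_le_one hq]; linarith
  have hexp : 4 * s * (k2 * (A * P) + k1 * (A * (-a * (P / (ε + s)))) +
        (k1 * (A * (-a * (P / (ε + s)))) +
          k0 * (A * (-a * ((-a - 1) * (P / (ε + s) / (ε + s))))))) +
      2 * N * (k1 * (A * P) + k0 * (A * (-a * (P / (ε + s))))) =
      A * (P / s) * (4 * (s ^ 2 * k2) - (8 * a * t) * (s * k1) + (4 * (a * (a + 1)) * t ^ 2) * k0
        + 2 * N * (s * k1) - (2 * N * a * t) * k0) := by
    rw [ht]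
    field_simp
    ring
  rw [hexp, abs_mul, abs_of_nonneg (by positivity : 0 ≤ A * (P / s))]
  have hb1 {c : ℝ} (C y : ℝ) (hc : 0 ≤ c) (hcC : c ≤ C) (hy : |y| ≤ M) : |c * y| ≤ C * M := by
    rw [abs_mul, abs_of_nonneg hc]
    exact mul_le_mul hcC hy (abs_nonneg _) (hc.trans hcC)
  have b1 := hb1 4 _ (by norm_num) le_rfl h2
  have b2 := hb1 (c := 8 * a * t) (8 * a) _ (by positivity)
    (mul_le_of_le_one_right (by positivity) ht1) h1
  have b3 := hb1 (c := 4 * (a * (a + 1)) * t ^ 2) (4 * (a * (a + 1))) _ (by positivity)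
    (mul_le_of_le_one_right (by positivity) (pow_le_one₀ ht0 ht1)) h0
  have b4 := hb1 (c := 2 * N) (2 * N) _ (by positivity) le_rfl h1
  have b5 := hb1 (c := 2 * N * a * t) (2 * N * a) _ (by positivity)
    (mul_le_of_le_one_right (by positivity) ht1) h0
  have hsum : |4 * (s ^ 2 * k2) - (8 * a * t) * (s * k1) + (4 * (a * (a + 1)) * t ^ 2) * k0
        + 2 * N * (s * k1) - (2 * N * a * t) * k0| ≤
      (4 * (1 + 2 * a + a * (a + 1)) + 2 * N * (1 + a)) * M := by
    rw [abs_le] at *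
    constructor <;> linarith [b1.1, b1.2, b2.1, b2.2, b3.1, b3.2, b4.1, b4.2, b5.1, b5.2]
  calc A * (P / s) * _ ≤ A * (S / s) * ((4 * (1 + 2 * a + a * (a + 1)) + 2 * N * (1 + a)) * M) := by
        gcongr
        exact mul_nonneg hA (div_nonneg (hP0.le.trans hP) hs.le)
    _ = _ := by ring

theorem contDiff_bubble {N : ℕ} {ε : ℝ} (hε : 0 < ε) {n : ℕ∞} : ContDiff ℝ n (bubble N ε) := by
  unfold bubble
  have hpos (x : EuclideanSpace ℝ (Fin N)) : 0 < ε + ‖x‖ ^ 2 := by positivity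
  refine contDiff_const.div ?_ fun x => (rpow_pos_of_pos (hpos x) _).ne'
  exact (contDiff_const.add (contDiff_norm_sq ℝ)).rpow_const_of_ne fun x => (hpos x).ne'

theorem contDiff_cutBubble {N : ℕ} {ε ρ : ℝ} (hε : 0 < ε) (hρ : 0 < ρ) {g : ℝ → ℝ}
    (hg : ContDiff ℝ (⊤ : ℕ∞) g) (hg1 : ∀ r : ℝ, 0 ≤ r → r ≤ ρ → g r = 1) :
    ContDiff ℝ 2 (cutBubble N g ε) := by
  unfold cutBubble
  refine ContDiff.mul ?_ (contDiff_bubble (n := 2) hε)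
  rw [contDiff_iff_contDiffAt]
  intro x
  rcases eq_or_ne x 0 with rfl | hx
  · refine (contDiffAt_const (c := (1 : ℝ))).congr_of_eventuallyEq ?_
    filter_upwards [Metric.ball_mem_nhds (0 : EuclideanSpace ℝ (Fin N)) hρ] with y hy
    exact hg1 _ (norm_nonneg y) (mem_ball_zero_iff.1 hy).le
  · exact (contDiff_infty.1 hg 2).contDiffAt.comp x (contDiffAt_norm ℝ hx)

theorem contDiffOn_comp_sqrt {g : ℝ → ℝ} (hg : ContDiff ℝ (⊤ : ℕ∞) g) :
    ContDiffOn ℝ 2 (fun s => g √s) (Set.Ioi 0) := fun _ hs =>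
  ((contDiff_infty.1 hg 2).contDiffAt.comp _
    (Real.contDiffAt_sqrt (ne_of_gt hs))).contDiffWithinAt

theorem lapl_cutBubble_sq_le {N : ℕ} (hN : 5 ≤ N) {ρ : ℝ} (hρ : 0 < ρ) {g : ℝ → ℝ}
    (hg : ContDiff ℝ (⊤ : ℕ∞) g) {M : ℝ}
    (hM : ∀ s, ρ ^ 2 ≤ s → |g √s| ≤ M ∧ |s * deriv (fun s => g √s) s| ≤ M ∧
      |s ^ 2 * deriv (deriv fun s => g √s) s| ≤ M) :
    ∃ K : ℝ, ∀ ε : ℝ, 0 < ε → ∀ x : EuclideanSpace ℝ (Fin N), ρ ≤ ‖x‖ →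
      lapl (cutBubble N g ε) x ^ 2 ≤
        K * ε ^ (((N : ℝ) - 4) / 2) * (1 + ‖x‖) ^ (-(2 * (N : ℝ) - 4)) := by
  have hN' : (5 : ℝ) ≤ N := by exact_mod_cast hN
  obtain ⟨a, ha⟩ : ∃ a : ℝ, a = ((N : ℝ) - 4) / 2 := ⟨_, rfl⟩
  have ha0 : 0 ≤ a := by rw [ha]; linarith
  obtain ⟨c, hc⟩ : ∃ c : ℝ, c = (N : ℝ) * ((N : ℝ) - 4) * ((N : ℝ) ^ 2 - 4) := ⟨_, rfl⟩
  have hc0 : 0 ≤ c := by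
    rw [hc]
    exact mul_nonneg (mul_nonneg (by linarith) (by linarith)) (by nlinarith)
  obtain ⟨C, hC⟩ : ∃ C : ℝ, C = (4 * (1 + 2 * a + a * (a + 1)) + 2 * N * (1 + a)) * M := ⟨_, rfl⟩
  refine ⟨c ^ (a / 2) * C ^ 2 * (1 / ρ + 1) ^ (2 * (N : ℝ) - 4), fun ε hε x hx => ?_⟩
  have hx0 : 0 < ‖x‖ := hρ.trans_le hx
  obtain ⟨h0, h1, h2⟩ := hM (‖x‖ ^ 2) (by gcongr)
  have hrep : cutBubble N g ε = fun y => (fun s => g √s) (‖y‖ ^ 2) *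
      ((c * ε ^ 2) ^ (a / 4) * (ε + ‖y‖ ^ 2) ^ (-a)) := by
    funext y
    simp only [cutBubble, bubble, sqrt_sq (norm_nonneg y)]
    rw [rpow_neg (by positivity), ← div_eq_mul_inv, ← hc, ← ha,
      show ((N : ℝ) - 4) / 8 = a / 4 by rw [ha]; ring]
  have hle := abs_lapl_radial_mul_rpow_le (contDiffOn_comp_sqrt hg) ha0
    (by positivity : 0 ≤ (c * ε ^ 2) ^ (a / 4)) hε hx0 h0 h1 h2
  rw [← hrep, ← hC] at hle
  have hA : ((c * ε ^ 2) ^ (a / 4)) ^ 2 = c ^ (a / 2) * ε ^ a := by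
    rw [← rpow_natCast, ← rpow_mul (by positivity), mul_rpow hc0 (by positivity),
      ← rpow_natCast ε 2, ← rpow_mul hε.le]
    congr 2 <;> push_cast <;> ring
  have hX : ((‖x‖ ^ 2) ^ (-a - 1)) ^ 2 = ‖x‖ ^ (-(2 * (N : ℝ) - 4)) := by
    rw [← rpow_natCast, ← rpow_natCast, ← rpow_mul hx0.le, ← rpow_mul hx0.le]
    congr 1
    rw [ha]
    push_cast
    ring
  have hcmp : ‖x‖ ^ (-(2 * (N : ℝ) - 4)) ≤
      (1 / ρ + 1) ^ (2 * (N : ℝ) - 4) * (1 + ‖x‖) ^ (-(2 * (N : ℝ) - 4)) := by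
    have h : 1 + ‖x‖ ≤ (1 / ρ + 1) * ‖x‖ := by
      have : 1 ≤ 1 / ρ * ‖x‖ := by rw [one_div_mul_eq_div, one_le_div hρ]; exact hx
      linarith
    have h' := rpow_le_rpow (by positivity) h (by linarith : 0 ≤ 2 * (N : ℝ) - 4)
    rw [mul_rpow (by positivity) hx0.le] at h'
    rw [rpow_neg hx0.le, rpow_neg (by positivity), ← div_eq_mul_inv, ← one_div,
      div_le_div_iff₀ (by positivity) (by positivity)]
    linarith
  calc lapl (cutBubble N g ε) x ^ 2
      = |lapl (cutBubble N g ε) x| ^ 2 := (sq_abs _).symm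
    _ ≤ ((c * ε ^ 2) ^ (a / 4) * C * (‖x‖ ^ 2) ^ (-a - 1)) ^ 2 := by gcongr
    _ = c ^ (a / 2) * ε ^ a * C ^ 2 * ‖x‖ ^ (-(2 * (N : ℝ) - 4)) := by
        rw [mul_pow, mul_pow, hA, hX]
    _ ≤ c ^ (a / 2) * ε ^ a * C ^ 2 *
        ((1 / ρ + 1) ^ (2 * (N : ℝ) - 4) * (1 + ‖x‖) ^ (-(2 * (N : ℝ) - 4))) := by gcongr
    _ = _ := by rw [← ha]; ring

theorem exists_abs_le_of_eq_zero {F : ℝ → ℝ} {a b : ℝ} (hF : ContinuousOn F (Set.Ici a))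
    (h0 : ∀ s, b < s → F s = 0) : ∃ M, ∀ s, a ≤ s → |F s| ≤ M := by
  obtain ⟨M, hM⟩ := (isCompact_Icc : IsCompact (Set.Icc a b)).exists_bound_of_continuousOn
    (hF.mono Set.Icc_subset_Ici_self)
  refine ⟨max M 0, fun s hs => ?_⟩
  rcases le_or_gt s b with h | h
  · exact (hM s ⟨hs, h⟩).trans (le_max_left _ _)
  · simp [h0 s h]

theorem exists_bound_derivs_comp_sqrt {ρ : ℝ} (hρ : 0 < ρ) {g : ℝ → ℝ}
    (hg : ContDiff ℝ (⊤ : ℕ∞) g) (hg0 : ∀ r : ℝ, 2 * ρ ≤ r → g r = 0) :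
    ∃ M, ∀ s, ρ ^ 2 ≤ s → |g √s| ≤ M ∧ |s * deriv (fun s => g √s) s| ≤ M ∧
      |s ^ 2 * deriv (deriv fun s => g √s) s| ≤ M := by
  have hk := contDiffOn_comp_sqrt hg
  have hk' := hk.deriv_of_isOpen (m := 1) isOpen_Ioi (by norm_num)
  have hk'' := hk'.deriv_of_isOpen (m := 0) isOpen_Ioi (by norm_num)
  have hsub : Set.Ici (ρ ^ 2) ⊆ Set.Ioi 0 := Set.Ici_subset_Ioi.2 (by positivity)
  have hz0 : ∀ s, (2 * ρ) ^ 2 < s → g √s = 0 := fun s hs => hg0 _ (le_sqrt_of_sq_le hs.le)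
  have hz1 : ∀ s, (2 * ρ) ^ 2 < s → deriv (fun s => g √s) s = 0 := fun s hs => by
    have h : (fun s => g √s) =ᶠ[𝓝 s] fun _ => 0 := by
      filter_upwards [Ioi_mem_nhds hs] with t ht using hz0 t ht
    rw [h.deriv_eq, deriv_const]
  have hz2 : ∀ s, (2 * ρ) ^ 2 < s → deriv (deriv fun s => g √s) s = 0 := fun s hs => by
    have h : (deriv fun s => g √s) =ᶠ[𝓝 s] fun _ => 0 := by
      filter_upwards [Ioi_mem_nhds hs] with t ht using hz1 t ht
    rw [h.deriv_eq, deriv_const]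
  obtain ⟨M0, h0⟩ := exists_abs_le_of_eq_zero (hk.continuousOn.mono hsub) hz0
  obtain ⟨M1, h1⟩ := exists_abs_le_of_eq_zero (b := (2 * ρ) ^ 2)
    (F := fun s => s * deriv (fun s => g √s) s)
    (continuousOn_id.mul (hk'.continuousOn.mono hsub)) fun s hs => by simp [hz1 s hs]
  obtain ⟨M2, h2⟩ := exists_abs_le_of_eq_zero (b := (2 * ρ) ^ 2)
    (F := fun s => s ^ 2 * deriv (deriv fun s => g √s) s)
    ((continuousOn_id.pow 2).mul (hk''.continuousOn.mono hsub)) fun s hs => by simp [hz2 s hs]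
  refine ⟨max M0 (max M1 M2), fun s hs => ⟨(h0 s hs).trans ?_, (h1 s hs).trans ?_,
    (h2 s hs).trans ?_⟩⟩ <;> simp

/-- For `N ≥ 5`: `∫ |ΔV_ε|² = ∫ |Δu_ε|² + O(ε^{(N−4)/2})` as `ε → 0⁺`. -/
theorem cutBubble_biharmonic_energy_estimate (N : ℕ) (hN : 5 ≤ N) (ρ : ℝ) (hρ : 0 < ρ)
    (g : ℝ → ℝ) (hg : ContDiff ℝ (⊤ : ℕ∞) g)
    (hg01 : ∀ r : ℝ, 0 ≤ r → g r ∈ Set.Icc (0 : ℝ) 1)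
    (hg1 : ∀ r : ℝ, 0 ≤ r → r ≤ ρ → g r = 1)
    (hg0 : ∀ r : ℝ, 2 * ρ ≤ r → g r = 0) :
    (fun ε : ℝ =>
        (∫ x : EuclideanSpace ℝ (Fin N), (lapl (cutBubble N g ε) x) ^ 2)
          - ∫ x : EuclideanSpace ℝ (Fin N), (lapl (bubble N ε) x) ^ 2)
      =O[𝓝[>] (0 : ℝ)] (fun ε : ℝ => ε ^ (((N : ℝ) - 4) / 2)) := by
  have hN' : (5 : ℝ) ≤ N := by exact_mod_cast hN
  obtain ⟨M, hM⟩ := exists_bound_derivs_comp_sqrt hρ hg hg0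
  obtain ⟨K₁, hK₁⟩ := lapl_cutBubble_sq_le hN hρ hg hM
  obtain ⟨K₂, hK₂⟩ := lapl_cutBubble_sq_le hN hρ (g := fun _ => 1) (M := 1) contDiff_const
    (fun s _ => by simp)
  have hbubble (ε : ℝ) : cutBubble N (fun _ => 1) ε = bubble N ε := by
    funext x
    simp [cutBubble]
  simp only [hbubble] at hK₂
  have hwint : Integrable (fun x : EuclideanSpace ℝ (Fin N) =>
      (1 + ‖x‖) ^ (-(2 * (N : ℝ) - 4))) :=
    integrable_one_add_norm (by rw [finrank_euclideanSpace_fin]; linarith)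
  refine IsBigO.of_bound ((|K₁| + |K₂|) * ∫ x : EuclideanSpace ℝ (Fin N),
    (1 + ‖x‖) ^ (-(2 * (N : ℝ) - 4))) ?_
  filter_upwards [self_mem_nhdsWithin] with ε hε
  replace hε : 0 < ε := hε
  have hV := continuous_lapl (contDiff_cutBubble (N := N) hε hρ hg hg1)
  have hU := continuous_lapl (contDiff_bubble (N := N) hε (n := 2))
  have hVint : Integrable fun x => lapl (cutBubble N g ε) x ^ 2 := by
    refine (hV.pow 2).integrable_of_hasCompactSupport
      (HasCompactSupport.intro (isCompact_closedBall 0 (2 * ρ)) fun x hx => ?_)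
    have hzero : cutBubble N g ε =ᶠ[𝓝 x] fun _ => 0 := by
      filter_upwards [Metric.isClosed_closedBall.isOpen_compl.mem_nhds hx] with y hy
      have hy' : 2 * ρ < ‖y‖ := by simpa using hy
      simp [cutBubble, hg0 _ hy'.le]
    rw [Pi.pow_apply, lapl_congr hzero]
    simp [lapl]
  have hdiff (x : EuclideanSpace ℝ (Fin N)) :
      ‖lapl (cutBubble N g ε) x ^ 2 - lapl (bubble N ε) x ^ 2‖ ≤
        (|K₁| + |K₂|) * ε ^ (((N : ℝ) - 4) / 2) * (1 + ‖x‖) ^ (-(2 * (N : ℝ) - 4)) := by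
    rcases lt_or_ge ‖x‖ ρ with hx | hx
    · have heq : cutBubble N g ε =ᶠ[𝓝 x] bubble N ε := by
        filter_upwards [Metric.isOpen_ball.mem_nhds (mem_ball_zero_iff.2 hx)] with y hy
        simp [cutBubble, hg1 _ (norm_nonneg y) (mem_ball_zero_iff.1 hy).le]
      rw [lapl_congr heq, sub_self, norm_zero]
      positivity
    · have hw : 0 ≤ ε ^ (((N : ℝ) - 4) / 2) * (1 + ‖x‖) ^ (-(2 * (N : ℝ) - 4)) := by positivity
      have hV' := hK₁ ε hε x hx
      have hU' := hK₂ ε hε x hx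
      rw [mul_assoc] at hV' hU'
      have h₁ := hV'.trans (mul_le_mul_of_nonneg_right (le_abs_self K₁) hw)
      have h₂ := hU'.trans (mul_le_mul_of_nonneg_right (le_abs_self K₂) hw)
      rw [mul_assoc, add_mul, norm_eq_abs, abs_le]
      constructor <;>
        linarith [sq_nonneg (lapl (cutBubble N g ε) x), sq_nonneg (lapl (bubble N ε) x)]
  have hdom := hwint.const_mul ((|K₁| + |K₂|) * ε ^ (((N : ℝ) - 4) / 2))
  have hdiffint : Integrable fun x =>
      lapl (cutBubble N g ε) x ^ 2 - lapl (bubble N ε) x ^ 2 :=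
    hdom.mono' ((hV.pow 2).sub (hU.pow 2)).aestronglyMeasurable (.of_forall hdiff)
  have hUint : Integrable fun x => lapl (bubble N ε) x ^ 2 := by
    simpa [Pi.sub_def] using hVint.sub hdiffint
  rw [← integral_sub hVint hUint]
  refine (norm_integral_le_of_norm_le hdom (.of_forall hdiff)).trans_eq ?_
  rw [integral_const_mul, norm_of_nonneg (rpow_nonneg hε.le _)]
  ring
end

section
/- Let N ≥ 8. Then ∫_{ℝ^N} V_ε(x)^{2N/(N−4)} dx = ∫_{ℝ^N} u_ε(x)^{2N/(N−4)} dx + O(ε^{N/2}) as ε → 0⁺. -/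
open MeasureTheory Real Filter Asymptotics
open scoped Topology

/-- The exponent `2N/(N-4)` turns the bubble into `K ε^{N/2} (ε + |x|²)^{-N}`. -/
lemma bubble_rpow_critical {N : ℕ} (hN : 8 ≤ N) {ε : ℝ} (hε : 0 < ε)
    (x : EuclideanSpace ℝ (Fin N)) :
    bubble N ε x ^ ((2 * (N : ℝ)) / ((N : ℝ) - 4)) =
      ((N : ℝ) * ((N : ℝ) - 4) * ((N : ℝ) ^ 2 - 4)) ^ ((N : ℝ) / 4) * ε ^ ((N : ℝ) / 2) *
        (ε + ‖x‖ ^ 2) ^ (-(N : ℝ)) := by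
  have hN' : (8 : ℝ) ≤ N := by exact_mod_cast hN
  have h4 : (N : ℝ) - 4 ≠ 0 := by linarith
  have hC : 0 ≤ (N : ℝ) * ((N : ℝ) - 4) * ((N : ℝ) ^ 2 - 4) :=
    mul_nonneg (mul_nonneg (by linarith) (by linarith)) (by nlinarith)
  have hs : 0 < ε + ‖x‖ ^ 2 := by positivity
  have e₁ : ((N : ℝ) - 4) / 8 * ((2 * (N : ℝ)) / ((N : ℝ) - 4)) = (N : ℝ) / 4 := by
    field_simp; norm_num
  have e₂ : ((N : ℝ) - 4) / 2 * ((2 * (N : ℝ)) / ((N : ℝ) - 4)) = (N : ℝ) := by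
    field_simp
  have e₃ : (ε ^ 2) ^ ((N : ℝ) / 4) = ε ^ ((N : ℝ) / 2) := by
    rw [← rpow_natCast, ← rpow_mul hε.le]
    congr 1
    push_cast
    ring
  rw [bubble, div_rpow (by positivity) (by positivity), ← rpow_mul (by positivity),
    ← rpow_mul hs.le, e₁, e₂, mul_rpow hC (by positivity), e₃, rpow_neg hs.le, div_eq_mul_inv]

lemma bubble_nonneg {N : ℕ} (hN : 8 ≤ N) {ε : ℝ} (hε : 0 < ε)
    (x : EuclideanSpace ℝ (Fin N)) : 0 ≤ bubble N ε x := by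
  have hN' : (8 : ℝ) ≤ N := by exact_mod_cast hN
  have hC : 0 ≤ (N : ℝ) * ((N : ℝ) - 4) * ((N : ℝ) ^ 2 - 4) :=
    mul_nonneg (mul_nonneg (by linarith) (by linarith)) (by nlinarith)
  unfold bubble
  positivity

lemma integrable_one_add_norm_sq_rpow_neg {N : ℕ} (hN : 0 < N) :
    Integrable (fun x : EuclideanSpace ℝ (Fin N) => (1 + ‖x‖ ^ 2) ^ (-(N : ℝ))) := by
  have hN' : (0 : ℝ) < N := by exact_mod_cast hN
  have h := integrable_rpow_neg_one_add_norm_sq (E := EuclideanSpace ℝ (Fin N))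
    (μ := volume) (r := 2 * (N : ℝ)) (by simp; linarith)
  convert h using 3
  ring

lemma rpow_neg_le_of_mul_le {c s t a : ℝ} (hc : 0 < c) (ht : 0 < t) (ha : 0 ≤ a)
    (h : c * t ≤ s) : s ^ (-a) ≤ c ^ (-a) * t ^ (-a) := by
  rw [← mul_rpow hc.le ht.le]
  exact rpow_le_rpow_of_nonpos (mul_pos hc ht) h (neg_nonpos.mpr ha)

lemma integrable_bubble_rpow_critical {N : ℕ} (hN : 8 ≤ N) {ε : ℝ} (hε : 0 < ε) :
    Integrable (fun x : EuclideanSpace ℝ (Fin N) =>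
      bubble N ε x ^ ((2 * (N : ℝ)) / ((N : ℝ) - 4))) := by
  simp_rw [bubble_rpow_critical hN hε]
  refine Integrable.const_mul ?_ _
  refine ((integrable_one_add_norm_sq_rpow_neg (N := N) (by omega)).const_mul
    ((min ε 1) ^ (-(N : ℝ)))).mono' (Measurable.aestronglyMeasurable (by fun_prop)) ?_
  refine Eventually.of_forall fun x => ?_
  rw [norm_of_nonneg (by positivity)]
  refine rpow_neg_le_of_mul_le (lt_min hε one_pos) (by positivity) (by positivity) ?_
  nlinarith [min_le_left ε 1, min_le_right ε 1, sq_nonneg ‖x‖]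

lemma cutBubble_rpow_mem_Icc {N : ℕ} (hN : 8 ≤ N) {g : ℝ → ℝ}
    (hg01 : ∀ r : ℝ, 0 ≤ r → g r ∈ Set.Icc (0 : ℝ) 1) {ε : ℝ} (hε : 0 < ε)
    {p : ℝ} (hp : 0 ≤ p) (x : EuclideanSpace ℝ (Fin N)) :
    cutBubble N g ε x ^ p ∈ Set.Icc 0 (bubble N ε x ^ p) := by
  obtain ⟨h0, h1⟩ := hg01 ‖x‖ (norm_nonneg x)
  have hb := bubble_nonneg hN hε x
  have hc : 0 ≤ cutBubble N g ε x := mul_nonneg h0 hb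
  exact ⟨rpow_nonneg hc p, rpow_le_rpow hc (mul_le_of_le_one_left hb h1) hp⟩

/-- For `N ≥ 8`: `∫ V_ε^{2N/(N−4)} = ∫ u_ε^{2N/(N−4)} + O(ε^{N/2})` as `ε → 0⁺`. -/
theorem cutBubble_critical_norm_estimate_high_dim (N : ℕ) (hN : 8 ≤ N) (ρ : ℝ) (hρ : 0 < ρ)
    (g : ℝ → ℝ) (hg : ContDiff ℝ (⊤ : ℕ∞) g)
    (hg01 : ∀ r : ℝ, 0 ≤ r → g r ∈ Set.Icc (0 : ℝ) 1)
    (hg1 : ∀ r : ℝ, 0 ≤ r → r ≤ ρ → g r = 1)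
    (hg0 : ∀ r : ℝ, 2 * ρ ≤ r → g r = 0) :
    (fun ε : ℝ =>
        (∫ x : EuclideanSpace ℝ (Fin N),
            (cutBubble N g ε x) ^ ((2 * (N : ℝ)) / ((N : ℝ) - 4)))
          - ∫ x : EuclideanSpace ℝ (Fin N),
              (bubble N ε x) ^ ((2 * (N : ℝ)) / ((N : ℝ) - 4)))
      =O[𝓝[>] (0 : ℝ)] (fun ε : ℝ => ε ^ ((N : ℝ) / 2)) := by
  have hN' : (8 : ℝ) ≤ N := by exact_mod_cast hN
  have hp : 0 ≤ (2 * (N : ℝ)) / ((N : ℝ) - 4) := div_nonneg (by linarith) (by linarith)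
  have hC : 0 ≤ (N : ℝ) * ((N : ℝ) - 4) * ((N : ℝ) ^ 2 - 4) :=
    mul_nonneg (mul_nonneg (by linarith) (by linarith)) (by nlinarith)
  set K : ℝ := ((N : ℝ) * ((N : ℝ) - 4) * ((N : ℝ) ^ 2 - 4)) ^ ((N : ℝ) / 4) with hK
  have hK0 : 0 ≤ K := rpow_nonneg hC _
  set c : ℝ := ρ ^ 2 / (1 + ρ ^ 2) with hc
  have hc0 : 0 < c := by positivity
  set J : ℝ := ∫ x : EuclideanSpace ℝ (Fin N), (1 + ‖x‖ ^ 2) ^ (-(N : ℝ))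
  refine IsBigO.of_bound (K * c ^ (-(N : ℝ)) * J) ?_
  filter_upwards [self_mem_nhdsWithin] with ε hε
  replace hε : 0 < ε := hε
  have hbi := integrable_bubble_rpow_critical hN hε
  have hgm : Measurable g := hg.continuous.measurable
  have hci : Integrable (fun x : EuclideanSpace ℝ (Fin N) =>
      cutBubble N g ε x ^ ((2 * (N : ℝ)) / ((N : ℝ) - 4))) := by
    refine hbi.mono' (Measurable.aestronglyMeasurable ?_) (Eventually.of_forall fun x => ?_)
    · unfold cutBubble bubble
      fun_prop
    · obtain ⟨h0, h1⟩ := cutBubble_rpow_mem_Icc hN hg01 hε hp x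
      rwa [norm_of_nonneg h0]
  rw [← integral_sub hci hbi, norm_of_nonneg (rpow_nonneg hε.le _)]
  have hbound := norm_integral_le_of_norm_le
    ((integrable_one_add_norm_sq_rpow_neg (N := N) (by omega)).const_mul
      (K * ε ^ ((N : ℝ) / 2) * c ^ (-(N : ℝ))))
    (f := fun x => cutBubble N g ε x ^ ((2 * (N : ℝ)) / ((N : ℝ) - 4)) -
      bubble N ε x ^ ((2 * (N : ℝ)) / ((N : ℝ) - 4)))
    (Eventually.of_forall fun x => ?_)
  · rw [integral_const_mul] at hbound
    exact hbound.trans_eq (by ring)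
  rcases le_total ‖x‖ ρ with hx | hx
  · rw [cutBubble, hg1 _ (norm_nonneg x) hx, one_mul, sub_self, norm_zero]
    positivity
  · obtain ⟨h0, h1⟩ := cutBubble_rpow_mem_Icc hN hg01 hε hp x
    have hcs : c * (1 + ‖x‖ ^ 2) ≤ ε + ‖x‖ ^ 2 := by
      have hx2 : ρ ^ 2 ≤ ‖x‖ ^ 2 := by gcongr
      rw [hc, div_mul_eq_mul_div, div_le_iff₀ (by positivity)]
      nlinarith [mul_pos hε (show 0 < 1 + ρ ^ 2 by positivity)]
    calc _ ≤ bubble N ε x ^ ((2 * (N : ℝ)) / ((N : ℝ) - 4)) := by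
          rw [norm_eq_abs, abs_of_nonpos (sub_nonpos.mpr h1)]
          linarith
      _ = K * ε ^ ((N : ℝ) / 2) * (ε + ‖x‖ ^ 2) ^ (-(N : ℝ)) := bubble_rpow_critical hN hε x
      _ ≤ K * ε ^ ((N : ℝ) / 2) * (c ^ (-(N : ℝ)) * (1 + ‖x‖ ^ 2) ^ (-(N : ℝ))) := by
          gcongr
          exact rpow_neg_le_of_mul_le hc0 (by positivity) (by positivity) hcs
      _ = _ := by ring
end

section
/- Let N > 8. Then ∫_{ℝ^N} V_ε(x)² dx = c_N K₂ ε² + O(ε^{(N−4)/2}) as ε → 0⁺, where c_N = (N(N−4)(N²−4))^{(N−4)/4} and K₂ = ∫_{ℝ^N} (1+|y|²)^{−(N−4)} dy (a finite positive constant since N > 8). -/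
open MeasureTheory Real Filter Asymptotics
open scoped Topology

/-- The weight `(ε + ‖x‖²)^(-s)` is integrable for `ε > 0` and `2 s > dim E`. -/
theorem integrable_add_norm_sq_rpow_neg (N : ℕ) {s ε : ℝ} (hs : (N : ℝ) < 2 * s) (hε : 0 < ε) :
    Integrable fun x : EuclideanSpace ℝ (Fin N) => (ε + ‖x‖ ^ 2) ^ (-s) := by
  have h1 : Integrable fun x : EuclideanSpace ℝ (Fin N) => (1 + ‖x‖ ^ 2) ^ (-s) := by
    have h := integrable_rpow_neg_one_add_norm_sq (E := EuclideanSpace ℝ (Fin N))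
      (μ := volume) (r := 2 * s) (by simpa using hs)
    simpa only [show -(2 * s) / 2 = -s by ring] using h
  have hR : (√ε)⁻¹ ≠ 0 := inv_ne_zero (Real.sqrt_pos.2 hε).ne'
  refine ((h1.comp_smul hR).const_mul (ε ^ (-s))).congr (.of_forall fun x => ?_)
  simp only [norm_smul, norm_inv, Real.norm_eq_abs, abs_of_nonneg (Real.sqrt_nonneg ε)]
  rw [← Real.mul_rpow hε.le (by positivity), mul_pow, inv_pow, Real.sq_sqrt hε.le]
  congr 1
  field_simp

/-- Scaling `x = √ε y` in the integral of `(ε + ‖x‖²)^(-s)`. -/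
theorem integral_add_norm_sq_rpow_neg (N : ℕ) (s : ℝ) {ε : ℝ} (hε : 0 < ε) :
    ∫ x : EuclideanSpace ℝ (Fin N), (ε + ‖x‖ ^ 2) ^ (-s) =
      ε ^ ((N : ℝ) / 2 - s) * ∫ x : EuclideanSpace ℝ (Fin N), (1 + ‖x‖ ^ 2) ^ (-s) := by
  have hpt (x : EuclideanSpace ℝ (Fin N)) :
      (ε + ‖x‖ ^ 2) ^ (-s) = ε ^ (-s) * (1 + ‖(√ε)⁻¹ • x‖ ^ 2) ^ (-s) := by
    rw [norm_smul, norm_inv, Real.norm_eq_abs, abs_of_nonneg (Real.sqrt_nonneg ε),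
      ← Real.mul_rpow hε.le (by positivity), mul_pow, inv_pow, Real.sq_sqrt hε.le]
    congr 1
    field_simp
  simp only [hpt]
  rw [integral_const_mul, Measure.integral_comp_smul volume
    (fun x : EuclideanSpace ℝ (Fin N) => (1 + ‖x‖ ^ 2) ^ (-s)), finrank_euclideanSpace_fin,
    inv_pow, inv_inv, abs_of_nonneg (by positivity), smul_eq_mul, ← mul_assoc, sub_eq_add_neg,
    add_comm, Real.rpow_add hε]
  congr 2
  rw [Real.sqrt_eq_rpow, ← Real.rpow_mul_natCast hε.le]
  congr 1
  ring

/-- Away from the origin the weights `(ε + ‖x‖²)^(-s)` are dominated uniformly in `ε`. -/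
theorem add_sq_rpow_neg_le {s ε ρ r : ℝ} (hs : 0 ≤ s) (hε : 0 < ε) (hρ : 0 < ρ) (hr : ρ ≤ r) :
    (ε + r ^ 2) ^ (-s) ≤ (1 + (ρ ^ 2)⁻¹) ^ s * (1 + r ^ 2) ^ (-s) := by
  have hr0 : 0 < r := hρ.trans_le hr
  have hA : 0 < 1 + (ρ ^ 2)⁻¹ := by positivity
  have key : 1 + r ^ 2 ≤ (1 + (ρ ^ 2)⁻¹) * (ε + r ^ 2) := by
    have h1 : 1 ≤ (ρ ^ 2)⁻¹ * r ^ 2 := by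
      rw [inv_mul_eq_div, one_le_div (by positivity)]
      gcongr
    have h2 : 0 ≤ (ρ ^ 2)⁻¹ * ε := by positivity
    linarith
  have h := Real.rpow_le_rpow (by positivity) key hs
  rw [Real.mul_rpow hA.le (by positivity)] at h
  rw [Real.rpow_neg (by positivity), Real.rpow_neg (by positivity), ← div_eq_mul_inv,
    inv_eq_one_div, div_le_div_iff₀ (by positivity) (by positivity), one_mul]
  exact h

/-- The square of the cut-off bubble. -/
theorem cutBubble_sq {N : ℕ} (hN : 4 < N) (g : ℝ → ℝ) {ε : ℝ} (hε : 0 < ε)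
    (x : EuclideanSpace ℝ (Fin N)) :
    cutBubble N g ε x ^ 2 =
      ((N : ℝ) * ((N : ℝ) - 4) * ((N : ℝ) ^ 2 - 4)) ^ (((N : ℝ) - 4) / 4) *
        ε ^ (((N : ℝ) - 4) / 2) * (g ‖x‖ ^ 2 * (ε + ‖x‖ ^ 2) ^ (-((N : ℝ) - 4))) := by
  have hN' : (4 : ℝ) < N := by exact_mod_cast hN
  have hA : 0 ≤ (N : ℝ) * ((N : ℝ) - 4) * ((N : ℝ) ^ 2 - 4) :=
    mul_nonneg (mul_nonneg (by linarith) (by linarith)) (by nlinarith)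
  have hw : 0 ≤ ε + ‖x‖ ^ 2 := by positivity
  rw [cutBubble, bubble, mul_pow, div_pow, ← Real.rpow_mul_natCast (by positivity),
    ← Real.rpow_mul_natCast hw, Real.mul_rpow hA (by positivity), ← Real.rpow_natCast_mul hε.le,
    Real.rpow_neg hw,
    show ((N : ℝ) - 4) / 8 * (2 : ℕ) = ((N : ℝ) - 4) / 4 by push_cast; ring,
    show ((N : ℝ) - 4) / 2 * (2 : ℕ) = (N : ℝ) - 4 by push_cast; ring,
    show ((2 : ℕ) : ℝ) * (((N : ℝ) - 4) / 4) = ((N : ℝ) - 4) / 2 by push_cast; ring]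
  ring

/-- For `N > 8`: `∫ V_ε² = c_N K₂ ε² + O(ε^{(N−4)/2})` as `ε → 0⁺`, where
`c_N = (N(N−4)(N²−4))^{(N−4)/4}` and `K₂ = ∫_{ℝ^N} (1+|y|²)^{−(N−4)} dy`. -/
theorem cutBubble_L2_norm_estimate_high_dim (N : ℕ) (hN : 8 < N) (ρ : ℝ) (hρ : 0 < ρ)
    (g : ℝ → ℝ) (hg : ContDiff ℝ (⊤ : ℕ∞) g)
    (hg01 : ∀ r : ℝ, 0 ≤ r → g r ∈ Set.Icc (0 : ℝ) 1)
    (hg1 : ∀ r : ℝ, 0 ≤ r → r ≤ ρ → g r = 1)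
    (hg0 : ∀ r : ℝ, 2 * ρ ≤ r → g r = 0)
    (cN K₂ : ℝ)
    (hcN : cN = ((N : ℝ) * ((N : ℝ) - 4) * ((N : ℝ) ^ 2 - 4)) ^ (((N : ℝ) - 4) / 4))
    (hK₂ : K₂ = ∫ y : EuclideanSpace ℝ (Fin N), (1 + ‖y‖ ^ 2) ^ (-((N : ℝ) - 4))) :
    (fun ε : ℝ =>
        (∫ x : EuclideanSpace ℝ (Fin N), (cutBubble N g ε x) ^ 2) - cN * K₂ * ε ^ 2)
      =O[𝓝[>] (0 : ℝ)] (fun ε : ℝ => ε ^ (((N : ℝ) - 4) / 2)) := by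
  have hN' : (8 : ℝ) < N := by exact_mod_cast hN
  set s : ℝ := (N : ℝ) - 4 with hs
  have hs0 : 0 ≤ s := by linarith
  have hNs : (N : ℝ) < 2 * s := by linarith
  have hA : 0 ≤ (N : ℝ) * s * ((N : ℝ) ^ 2 - 4) :=
    mul_nonneg (by positivity) (by nlinarith)
  have hcN0 : 0 ≤ cN := hcN ▸ Real.rpow_nonneg hA _
  set C : ℝ := (1 + (ρ ^ 2)⁻¹) ^ s with hC
  refine IsBigO.of_bound (cN * (C * K₂)) ?_
  filter_upwards [self_mem_nhdsWithin] with ε hε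
  have hε : 0 < ε := hε
  have hw := integrable_add_norm_sq_rpow_neg N hNs hε
  have hw1 := integrable_add_norm_sq_rpow_neg N hNs one_pos
  have hg01' (x : EuclideanSpace ℝ (Fin N)) : 0 ≤ g ‖x‖ ^ 2 ∧ g ‖x‖ ^ 2 ≤ 1 := by
    obtain ⟨h0, h1⟩ := hg01 ‖x‖ (norm_nonneg x)
    exact ⟨sq_nonneg _, pow_le_one₀ h0 h1⟩
  have hgw : Integrable fun x : EuclideanSpace ℝ (Fin N) =>
      g ‖x‖ ^ 2 * (ε + ‖x‖ ^ 2) ^ (-s) := by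
    refine hw.bdd_mul (c := 1) ?_ (.of_forall fun x => ?_)
    · exact ((hg.continuous.comp continuous_norm).pow 2).aestronglyMeasurable
    · rw [Real.norm_eq_abs, abs_of_nonneg (hg01' x).1]
      exact (hg01' x).2
  have hpow : ε ^ (s / 2) * ε ^ ((N : ℝ) / 2 - s) = ε ^ 2 := by
    rw [← Real.rpow_add hε, ← Real.rpow_natCast]
    congr 1
    push_cast
    linarith
  have hle (x : EuclideanSpace ℝ (Fin N)) :
      (ε + ‖x‖ ^ 2) ^ (-s) - g ‖x‖ ^ 2 * (ε + ‖x‖ ^ 2) ^ (-s) ≤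
        C * (1 + ‖x‖ ^ 2) ^ (-s) := by
    have hw0 : 0 ≤ (ε + ‖x‖ ^ 2) ^ (-s) := by positivity
    rcases le_total ‖x‖ ρ with h | h
    · rw [hg1 _ (norm_nonneg x) h, one_pow, one_mul, sub_self]
      positivity
    · exact (sub_le_self _ (mul_nonneg (hg01' x).1 hw0)).trans
        (add_sq_rpow_neg_le hs0 hε hρ h)
  have hdiff0 : 0 ≤ ∫ x : EuclideanSpace ℝ (Fin N),
      ((ε + ‖x‖ ^ 2) ^ (-s) - g ‖x‖ ^ 2 * (ε + ‖x‖ ^ 2) ^ (-s)) :=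
    integral_nonneg fun x => sub_nonneg.2 <|
      mul_le_of_le_one_left (by positivity) (hg01' x).2
  have hdiff1 := integral_mono (hw.sub hgw) (hw1.const_mul C) hle
  simp only [Pi.sub_apply] at hdiff1
  rw [integral_const_mul, ← hK₂] at hdiff1
  set D := ∫ x : EuclideanSpace ℝ (Fin N),
      ((ε + ‖x‖ ^ 2) ^ (-s) - g ‖x‖ ^ 2 * (ε + ‖x‖ ^ 2) ^ (-s)) with hD
  rw [integral_sub hw hgw, integral_add_norm_sq_rpow_neg N s hε, ← hK₂] at hD
  have hmain : (∫ x : EuclideanSpace ℝ (Fin N), cutBubble N g ε x ^ 2) - cN * K₂ * ε ^ 2 =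
      -(cN * ε ^ (s / 2) * D) := by
    simp only [cutBubble_sq (by omega : 4 < N) g hε]
    rw [← hs, ← hcN, integral_const_mul, hD, ← hpow]
    ring
  have hεs : 0 ≤ ε ^ (s / 2) := by positivity
  rw [hmain, norm_neg, Real.norm_of_nonneg (by positivity), Real.norm_of_nonneg hεs]
  calc cN * ε ^ (s / 2) * D ≤ cN * ε ^ (s / 2) * (C * K₂) := by gcongr
    _ = cN * (C * K₂) * ε ^ (s / 2) := by ring
end

section
/- Let N = 8. Then ∫_{ℝ^8} V_ε(x)² dx = (1/2) c₈ ω₈ ε² log(1/ε) + O(ε²) as ε → 0⁺, where c₈ = (8·4·60)² = (8(8−4)(8²−4))^{(8−4)/4} and ω₈ is the surface area of the unit sphere in ℝ⁸. -/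
open MeasureTheory Real Filter Asymptotics
open scoped Topology

/-- The surface area of the unit sphere in `ℝ^N`, i.e. `N` times the volume of
the unit ball. -/
noncomputable def sphereArea (N : ℕ) : ℝ :=
  (N : ℝ) * (volume (Metric.ball (0 : EuclideanSpace ℝ (Fin N)) 1)).toReal

/-- Explicit value of the radial integral `∫₀^ρ r⁷ / (ε + r²)⁴ dr`. -/
theorem integral_pow_seven_div (ε ρ : ℝ) (hε : 0 < ε) :
    ∫ y in (0 : ℝ)..ρ, y ^ 7 / (ε + y ^ 2) ^ 4 =
      (1 / 2) * (Real.log (ε + ρ ^ 2) + 3 * (ε / (ε + ρ ^ 2)) - 3 / 2 * (ε / (ε + ρ ^ 2)) ^ 2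
        + 1 / 3 * (ε / (ε + ρ ^ 2)) ^ 3) + (1 / 2) * Real.log (1 / ε) - 11 / 12 := by
  have hpos : ∀ y : ℝ, 0 < ε + y ^ 2 := fun y => by positivity
  have hderiv : ∀ y ∈ Set.uIcc (0 : ℝ) ρ, HasDerivAt
      (fun y => (1 / 2) * (Real.log (ε + y ^ 2) + 3 * (ε / (ε + y ^ 2))
        - 3 / 2 * (ε / (ε + y ^ 2)) ^ 2 + 1 / 3 * (ε / (ε + y ^ 2)) ^ 3))
      (y ^ 7 / (ε + y ^ 2) ^ 4) y := by
    intro y _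
    have hs : HasDerivAt (fun y : ℝ => ε + y ^ 2) (2 * y) y := by
      simpa using (hasDerivAt_pow 2 y).const_add ε
    have hy := (hpos y).ne'
    have hq := (hasDerivAt_const y ε).fun_div hs hy
    refine HasDerivAt.congr_deriv (((((hs.log hy).fun_add (hq.const_mul 3)).fun_sub
      ((hq.fun_pow 2).const_mul (3 / 2))).fun_add ((hq.fun_pow 3).const_mul (1 / 3))).const_mul
        (1 / 2 : ℝ)) ?_
    simp only [Nat.add_one_sub_one, pow_one]
    push_cast
    field_simp
    ring
  have hcont : Continuous fun y : ℝ => y ^ 7 / (ε + y ^ 2) ^ 4 :=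
    by fun_prop (disch := intro y; exact (pow_pos (hpos y) 4).ne')
  rw [intervalIntegral.integral_eq_sub_of_hasDerivAt hderiv (hcont.intervalIntegrable 0 ρ)]
  simp only [ne_eq, OfNat.ofNat_ne_zero, not_false_eq_true, zero_pow, add_zero,
    div_self hε.ne', one_div, Real.log_inv]
  ring

/-- The radial integral is `(1/2) log (1/ε)` up to a bounded error. -/
theorem abs_radial_integral_sub_log_le {ρ : ℝ} (hρ : 0 < ρ) {g : ℝ → ℝ} (hg : Continuous g)
    (hg01 : ∀ r : ℝ, 0 ≤ r → g r ∈ Set.Icc (0 : ℝ) 1)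
    (hg1 : ∀ r : ℝ, 0 ≤ r → r ≤ ρ → g r = 1)
    (hg0 : ∀ r : ℝ, 2 * ρ ≤ r → g r = 0) {ε : ℝ} (hε : 0 < ε) (hε1 : ε < 1) :
    |(∫ y in Set.Ioi (0 : ℝ), y ^ 7 * (g y ^ 2 / (ε + y ^ 2) ^ 4))
        - (1 / 2) * Real.log (1 / ε)|
      ≤ |Real.log (ρ ^ 2)| + |Real.log (1 + ρ ^ 2)| + 6 := by
  have hpos : ∀ y : ℝ, 0 < ε + y ^ 2 := fun y => by positivity
  have hcont : Continuous fun y : ℝ => y ^ 7 * (g y ^ 2 / (ε + y ^ 2) ^ 4) :=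
    by fun_prop (disch := intro y; exact (pow_pos (hpos y) 4).ne')
  have htrunc : (∫ y in Set.Ioi (0 : ℝ), y ^ 7 * (g y ^ 2 / (ε + y ^ 2) ^ 4))
      = ∫ y in (0 : ℝ)..(2 * ρ), y ^ 7 * (g y ^ 2 / (ε + y ^ 2) ^ 4) := by
    rw [intervalIntegral.integral_of_le (by positivity)]
    refine setIntegral_eq_of_subset_of_forall_sdiff_eq_zero measurableSet_Ioi
      (fun y hy => hy.1) fun y hy => ?_
    have hy2 : 2 * ρ ≤ y := by
      by_contra! h
      exact hy.2 ⟨hy.1, h.le⟩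
    simp [hg0 y hy2]
  have hinner : (∫ y in (0 : ℝ)..ρ, y ^ 7 * (g y ^ 2 / (ε + y ^ 2) ^ 4))
      = ∫ y in (0 : ℝ)..ρ, y ^ 7 / (ε + y ^ 2) ^ 4 := by
    refine intervalIntegral.integral_congr fun y hy => ?_
    rw [Set.uIcc_of_le hρ.le] at hy
    simp [hg1 y hy.1 hy.2, div_eq_mul_inv]
  have houter : |∫ y in ρ..(2 * ρ), y ^ 7 * (g y ^ 2 / (ε + y ^ 2) ^ 4)| ≤ 1 := by
    have hbound : ∀ y ∈ Set.uIoc ρ (2 * ρ),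
        ‖y ^ 7 * (g y ^ 2 / (ε + y ^ 2) ^ 4)‖ ≤ 1 / ρ := by
      intro y hy
      rw [Set.uIoc_of_le (by linarith)] at hy
      have hy0 : 0 < y := hρ.trans hy.1
      obtain ⟨h0, h1⟩ := hg01 y hy0.le
      have hge := hpos y
      rw [Real.norm_of_nonneg (by positivity)]
      calc y ^ 7 * (g y ^ 2 / (ε + y ^ 2) ^ 4) ≤ y ^ 7 * (1 / (y ^ 2) ^ 4) := by
            gcongr
            · exact pow_le_one₀ h0 h1
            · linarith
        _ = 1 / y := by field_simp
        _ ≤ 1 / ρ := one_div_le_one_div_of_le hρ hy.1.le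
    refine (intervalIntegral.norm_integral_le_of_norm_le_const hbound).trans_eq ?_
    rw [show 2 * ρ - ρ = ρ by ring, abs_of_pos hρ, one_div_mul_cancel hρ.ne']
  rw [htrunc, ← intervalIntegral.integral_add_adjacent_intervals
    (hcont.intervalIntegrable 0 ρ) (hcont.intervalIntegrable ρ (2 * ρ)), hinner,
    integral_pow_seven_div ε ρ hε]
  have ht0 : 0 ≤ ε / (ε + ρ ^ 2) := by positivity
  have ht1 : ε / (ε + ρ ^ 2) ≤ 1 := (div_le_one (hpos ρ)).2 (by nlinarith [sq_nonneg ρ])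
  set t := ε / (ε + ρ ^ 2)
  have ht2 : t ^ 2 ≤ 1 := pow_le_one₀ ht0 ht1
  have ht3 : t ^ 3 ≤ 1 := pow_le_one₀ ht0 ht1
  have ht2' : 0 ≤ t ^ 2 := by positivity
  have ht3' : 0 ≤ t ^ 3 := by positivity
  have hlog_lower : Real.log (ρ ^ 2) ≤ Real.log (ε + ρ ^ 2) :=
    Real.log_le_log (by positivity) (by linarith)
  have hlog_upper : Real.log (ε + ρ ^ 2) ≤ Real.log (1 + ρ ^ 2) :=
    Real.log_le_log (hpos ρ) (by linarith)
  have := neg_abs_le (Real.log (ρ ^ 2))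
  have := abs_nonneg (Real.log (ρ ^ 2))
  have := le_abs_self (Real.log (1 + ρ ^ 2))
  have := abs_nonneg (Real.log (1 + ρ ^ 2))
  obtain ⟨_, _⟩ := abs_le.1 houter
  rw [abs_le]
  constructor <;> linarith

/-- In dimension `8`, the square of the truncated bubble as a function of the radius. -/
theorem cutBubble_eight_sq (g : ℝ → ℝ) {ε : ℝ} (hε : 0 < ε) (x : EuclideanSpace ℝ (Fin 8)) :
    cutBubble 8 g ε x ^ 2 = 1920 * ε ^ 2 * (g ‖x‖ ^ 2 / (ε + ‖x‖ ^ 2) ^ 4) := by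
  have hnum : (((8 : ℕ) : ℝ) * (((8 : ℕ) : ℝ) - 4) * (((8 : ℕ) : ℝ) ^ 2 - 4) * ε ^ 2) ^
      ((((8 : ℕ) : ℝ) - 4) / 8) = √(1920 * ε ^ 2) := by
    rw [Real.sqrt_eq_rpow]
    norm_num
  have hden : (ε + ‖x‖ ^ 2) ^ ((((8 : ℕ) : ℝ) - 4) / 2) = (ε + ‖x‖ ^ 2) ^ 2 := by
    rw [← Real.rpow_natCast]
    norm_num
  rw [cutBubble, bubble, hnum, hden, mul_pow, div_pow, Real.sq_sqrt (by positivity)]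
  ring

/-- Polar coordinates for the squared `L²` norm of the truncated bubble in dimension `8`. -/
theorem integral_cutBubble_eight_sq (g : ℝ → ℝ) {ε : ℝ} (hε : 0 < ε) :
    ∫ x : EuclideanSpace ℝ (Fin 8), cutBubble 8 g ε x ^ 2 =
      1920 * sphereArea 8 * ε ^ 2 *
        ∫ y in Set.Ioi (0 : ℝ), y ^ 7 * (g y ^ 2 / (ε + y ^ 2) ^ 4) := by
  simp_rw [cutBubble_eight_sq g hε]
  rw [integral_const_mul, integral_fun_norm_addHaar (volume : Measure (EuclideanSpace ℝ (Fin 8)))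
    (fun y => g y ^ 2 / (ε + y ^ 2) ^ 4)]
  simp only [finrank_euclideanSpace, Fintype.card_fin, nsmul_eq_mul, smul_eq_mul, sphereArea,
    Measure.real, Nat.add_one_sub_one]
  ring

/-- For `N = 8`: `∫ V_ε² = (1/2) c₈ ω₈ ε² log(1/ε) + O(ε²)` as `ε → 0⁺`, where
`c₈ = (8(8−4)(8²−4))^{(8−4)/4}` and `ω₈` is the area of the unit sphere in `ℝ⁸`. -/
theorem cutBubble_L2_norm_estimate_dim8 (ρ : ℝ) (hρ : 0 < ρ)
    (g : ℝ → ℝ) (hg : ContDiff ℝ (⊤ : ℕ∞) g)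
    (hg01 : ∀ r : ℝ, 0 ≤ r → g r ∈ Set.Icc (0 : ℝ) 1)
    (hg1 : ∀ r : ℝ, 0 ≤ r → r ≤ ρ → g r = 1)
    (hg0 : ∀ r : ℝ, 2 * ρ ≤ r → g r = 0)
    (c₈ : ℝ)
    (hc₈ : c₈ = ((8 : ℝ) * ((8 : ℝ) - 4) * ((8 : ℝ) ^ 2 - 4)) ^ (((8 : ℝ) - 4) / 4)) :
    (fun ε : ℝ =>
        (∫ x : EuclideanSpace ℝ (Fin 8), (cutBubble 8 g ε x) ^ 2)
          - (1 / 2) * c₈ * sphereArea 8 * ε ^ 2 * Real.log (1 / ε))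
      =O[𝓝[>] (0 : ℝ)] (fun ε : ℝ => ε ^ 2) := by
  have hc : c₈ = 1920 := by
    rw [hc₈]
    norm_num
  refine IsBigO.of_bound
    (1920 * |sphereArea 8| * (|Real.log (ρ ^ 2)| + |Real.log (1 + ρ ^ 2)| + 6)) ?_
  filter_upwards [Ioo_mem_nhdsGT (zero_lt_one (α := ℝ))] with ε hε
  rw [integral_cutBubble_eight_sq g hε.1, hc,
    show ∀ I L : ℝ, 1920 * sphereArea 8 * ε ^ 2 * I - 1 / 2 * 1920 * sphereArea 8 * ε ^ 2 * L
      = 1920 * sphereArea 8 * (I - 1 / 2 * L) * ε ^ 2 by intro I L; ring,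
    norm_mul, Real.norm_eq_abs (_ * (_ - _)), abs_mul, abs_mul,
    abs_of_pos (by norm_num : (0 : ℝ) < 1920)]
  gcongr
  exact abs_radial_integral_sub_log_le hρ hg.continuous hg01 hg1 hg0 hε.1 hε.2
end

section
/- Let 5 ≤ N ≤ 7. Then ∫_{ℝ^N} V_ε(x)² dx = O(ε^{(N−4)/2}) as ε → 0⁺. -/
open MeasureTheory Real Filter Asymptotics
open scoped Topology

/-- A truncated negative power of the norm is integrable when the singularity is weak enough. -/
lemma integrable_indicator_inv_norm_pow {E : Type*} [NormedAddCommGroup E] [NormedSpace ℝ E]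
    [Nontrivial E] [FiniteDimensional ℝ E] [MeasurableSpace E] [BorelSpace E]
    (μ : Measure E) [μ.IsAddHaarMeasure] (m : ℕ) (hm : m < Module.finrank ℝ E) (R : ℝ) :
    Integrable (fun x : E => (Set.Iio R).indicator (fun r : ℝ => (r ^ m)⁻¹) ‖x‖) μ := by
  rw [integrable_fun_norm_addHaar μ (f := (Set.Iio R).indicator fun r : ℝ => (r ^ m)⁻¹)]
  have hpow : IntegrableOn (fun y : ℝ => y ^ (Module.finrank ℝ E - 1 - m)) (Set.Ioo 0 R) :=
    ((continuous_pow _).integrableOn_Icc (a := 0) (b := R)).mono_set Set.Ioo_subset_Icc_self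
  have hind := hpow.integrable_indicator measurableSet_Ioo
  refine (hind.integrableOn (s := Set.Ioi 0)).congr_fun (fun y hy => ?_) measurableSet_Ioi
  have hy : 0 < y := hy
  by_cases hyR : y < R
  · simp only [Set.indicator, Set.mem_Ioo, Set.mem_Iio, hy, hyR, and_self, if_true, smul_eq_mul]
    rw [pow_sub₀ y hy.ne' (by omega)]
  · simp [Set.indicator, hyR]

/-- The square of the bubble is dominated, up to its scaling factor, by a negative power of the
norm. -/
lemma sq_bubble_le {N : ℕ} (hN : 4 ≤ N) {ε : ℝ} (hε : 0 < ε) {x : EuclideanSpace ℝ (Fin N)}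
    (hx : x ≠ 0) :
    bubble N ε x ^ 2 ≤
      (((N : ℝ) * ((N : ℝ) - 4) * ((N : ℝ) ^ 2 - 4)) ^ (((N : ℝ) - 4) / 8)) ^ 2 *
        ε ^ (((N : ℝ) - 4) / 2) * (‖x‖ ^ (2 * (N - 4)))⁻¹ := by
  have hN4 : (4 : ℝ) ≤ N := by exact_mod_cast hN
  have hA : 0 ≤ (N : ℝ) * ((N : ℝ) - 4) * ((N : ℝ) ^ 2 - 4) :=
    mul_nonneg (mul_nonneg (by linarith) (by linarith)) (by nlinarith)
  have hx' : 0 < ‖x‖ := norm_pos_iff.mpr hx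
  have hεpow : ((ε ^ 2) ^ (((N : ℝ) - 4) / 8)) ^ 2 = ε ^ (((N : ℝ) - 4) / 2) := by
    rw [← rpow_natCast ε 2, ← rpow_mul hε.le, ← rpow_natCast, ← rpow_mul hε.le]
    congr 1
    push_cast
    ring
  have hden : ((ε + ‖x‖ ^ 2) ^ (((N : ℝ) - 4) / 2)) ^ 2 = (ε + ‖x‖ ^ 2) ^ (N - 4) := by
    rw [← rpow_natCast, ← rpow_mul (by positivity), ← rpow_natCast _ (N - 4)]
    congr 1
    push_cast [Nat.cast_sub hN]
    ring
  rw [bubble, div_pow, mul_rpow hA (by positivity), mul_pow, hεpow, hden, div_eq_mul_inv, pow_mul]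
  gcongr
  linarith

/-- For `5 ≤ N ≤ 7`: `∫ V_ε² = O(ε^{(N−4)/2})` as `ε → 0⁺`. -/
theorem cutBubble_L2_norm_estimate_low_dim (N : ℕ) (hN : 5 ≤ N) (hN' : N ≤ 7)
    (ρ : ℝ) (hρ : 0 < ρ)
    (g : ℝ → ℝ) (hg : ContDiff ℝ (⊤ : ℕ∞) g)
    (hg01 : ∀ r : ℝ, 0 ≤ r → g r ∈ Set.Icc (0 : ℝ) 1)
    (hg1 : ∀ r : ℝ, 0 ≤ r → r ≤ ρ → g r = 1)
    (hg0 : ∀ r : ℝ, 2 * ρ ≤ r → g r = 0) :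
    (fun ε : ℝ => ∫ x : EuclideanSpace ℝ (Fin N), (cutBubble N g ε x) ^ 2)
      =O[𝓝[>] (0 : ℝ)] (fun ε : ℝ => ε ^ (((N : ℝ) - 4) / 2)) := by
  have : Nonempty (Fin N) := ⟨⟨0, by omega⟩⟩
  have hint := integrable_indicator_inv_norm_pow
    (volume : Measure (EuclideanSpace ℝ (Fin N))) (2 * (N - 4))
    (by rw [finrank_euclideanSpace_fin]; omega) (2 * ρ)
  set w : EuclideanSpace ℝ (Fin N) → ℝ :=
    fun x => (Set.Iio (2 * ρ)).indicator (fun r : ℝ => (r ^ (2 * (N - 4)))⁻¹) ‖x‖ with hw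
  set K := (((N : ℝ) * ((N : ℝ) - 4) * ((N : ℝ) ^ 2 - 4)) ^ (((N : ℝ) - 4) / 8)) ^ 2
  refine IsBigO.of_bound (K * ∫ x, w x) ?_
  filter_upwards [self_mem_nhdsWithin] with ε hε
  have hε : 0 < ε := hε
  rw [norm_of_nonneg (integral_nonneg fun x => sq_nonneg _), norm_of_nonneg (by positivity)]
  have hmono : ∫ x, cutBubble N g ε x ^ 2 ≤ ∫ x, K * ε ^ (((N : ℝ) - 4) / 2) * w x := by
    refine integral_mono_of_nonneg (.of_forall fun x => sq_nonneg _) (hint.const_mul _) ?_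
    filter_upwards [compl_mem_ae_iff.mpr (measure_singleton (0 : EuclideanSpace ℝ (Fin N)))]
      with x hx
    by_cases hxρ : ‖x‖ < 2 * ρ
    · obtain ⟨h0, h1⟩ := hg01 ‖x‖ (norm_nonneg x)
      have hwx : w x = (‖x‖ ^ (2 * (N - 4)))⁻¹ := by simp [hw, hxρ]
      rw [cutBubble, mul_pow, hwx]
      exact (mul_le_of_le_one_left (sq_nonneg _) (pow_le_one₀ h0 h1)).trans
        (sq_bubble_le (by omega) hε hx)
    · simp [cutBubble, hg0 ‖x‖ (not_lt.mp hxρ), hw, hxρ]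
  rw [integral_const_mul] at hmono
  linarith
end

section
/- Let N ≥ 8. Then ∫_{ℝ^N} |∇V_ε(x)|² dx = C_N K₁ ε + O(ε^{(N−4)/2}) as ε → 0⁺, where C_N = c_N (N−4)² with c_N = (N(N−4)(N²−4))^{(N−4)/4}, and K₁ = ∫_{ℝ^N} |y|²/(1+|y|²)^{N−2} dy (a finite positive constant since N ≥ 8). -/
open MeasureTheory Real Filter Asymptotics
open scoped Topology

/-- The defect between the squared slopes of the truncated and the untruncated radial profile
`(ε + r²)^{-(N-4)/2}`. -/
noncomputable def slopeDefect (N : ℕ) (g : ℝ → ℝ) (ε r : ℝ) : ℝ :=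
  ((deriv g r - ((N : ℝ) - 4) * g r * r / (ε + r ^ 2)) ^ 2
    - (((N : ℝ) - 4) * r / (ε + r ^ 2)) ^ 2) / (ε + r ^ 2) ^ (N - 4)

theorem norm_gradient_comp_norm {N : ℕ} {h : ℝ → ℝ} {h' : ℝ}
    {x : EuclideanSpace ℝ (Fin N)} (hx : x ≠ 0) (hh : HasDerivAt h h' ‖x‖) :
    ‖gradient (fun y : EuclideanSpace ℝ (Fin N) => h ‖y‖) x‖ = |h'| := by
  have hd : DifferentiableAt ℝ (fun y : EuclideanSpace ℝ (Fin N) => ‖y‖) x :=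
    differentiableAt_id.norm ℝ hx
  have : Nontrivial (EuclideanSpace ℝ (Fin N)) := ⟨x, 0, hx⟩
  have hc := hh.comp_hasFDerivAt x hd.hasFDerivAt
  have he : fderiv ℝ (fun y : EuclideanSpace ℝ (Fin N) => h ‖y‖) x
      = h' • fderiv ℝ (fun y : EuclideanSpace ℝ (Fin N) => ‖y‖) x := hc.fderiv
  rw [gradient, LinearIsometryEquiv.norm_map, he, norm_smul, norm_fderiv_norm hd, mul_one,
    Real.norm_eq_abs]

theorem hasDerivAt_radial_profile {g : ℝ → ℝ} {r ε : ℝ} (hg : DifferentiableAt ℝ g r)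
    (hε : 0 < ε) (K s : ℝ) :
    HasDerivAt (fun t => g t * (K / (ε + t ^ 2) ^ s))
      (K / (ε + r ^ 2) ^ s * (deriv g r - 2 * s * g r * r / (ε + r ^ 2))) r := by
  have hpos : 0 < ε + r ^ 2 := by positivity
  have h1 : HasDerivAt (fun t : ℝ => ε + t ^ 2) (2 * r) r := by
    simpa using (hasDerivAt_pow 2 r).const_add ε
  have h2 := h1.rpow_const (p := s) (Or.inl hpos.ne')
  have h3 := hg.hasDerivAt.mul ((hasDerivAt_const r K).div h2 (Real.rpow_pos_of_pos hpos s).ne')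
  refine h3.congr_deriv ?_
  have hs : (ε + r ^ 2) ^ s ≠ 0 := (Real.rpow_pos_of_pos hpos s).ne'
  rw [Real.rpow_sub_one hpos.ne']
  simp only [Pi.div_apply]
  field_simp
  ring

theorem sq_rpow_half_sub {N : ℕ} (hN : 4 ≤ N) {a : ℝ} (ha : 0 ≤ a) :
    (a ^ (((N : ℝ) - 4) / 2)) ^ 2 = a ^ (N - 4) := by
  rw [← Real.rpow_natCast, ← Real.rpow_mul ha, ← Real.rpow_natCast]
  congr 1
  push_cast [Nat.cast_sub hN]
  ring

theorem sq_bubble_coeff {N : ℕ} (hN : 4 ≤ N) {ε : ℝ} (hε : 0 < ε) :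
    (((N : ℝ) * ((N : ℝ) - 4) * ((N : ℝ) ^ 2 - 4) * ε ^ 2) ^ (((N : ℝ) - 4) / 8)) ^ 2
      = ((N : ℝ) * ((N : ℝ) - 4) * ((N : ℝ) ^ 2 - 4)) ^ (((N : ℝ) - 4) / 4)
        * ε ^ (((N : ℝ) - 4) / 2) := by
  have hN' : (4 : ℝ) ≤ N := by exact_mod_cast hN
  have h1 : 0 ≤ (N : ℝ) * ((N : ℝ) - 4) * ((N : ℝ) ^ 2 - 4) :=
    mul_nonneg (mul_nonneg (by linarith) (by linarith)) (by nlinarith)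
  rw [Real.mul_rpow h1 (by positivity), mul_pow, ← Real.rpow_mul_natCast h1,
    ← Real.rpow_natCast_mul hε.le, ← Real.rpow_mul_natCast hε.le]
  congr 2 <;> push_cast <;> ring

theorem sq_norm_gradient_cutBubble {N : ℕ} (hN : 4 ≤ N) {g : ℝ → ℝ} (hg : Differentiable ℝ g)
    {ε : ℝ} (hε : 0 < ε) {x : EuclideanSpace ℝ (Fin N)} (hx : x ≠ 0) :
    ‖gradient (cutBubble N g ε) x‖ ^ 2
      = ((N : ℝ) * ((N : ℝ) - 4) * ((N : ℝ) ^ 2 - 4)) ^ (((N : ℝ) - 4) / 4)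
        * ε ^ (((N : ℝ) - 4) / 2)
        * (((N : ℝ) - 4) ^ 2 * (‖x‖ ^ 2 / (ε + ‖x‖ ^ 2) ^ (N - 2)) + slopeDefect N g ε ‖x‖) := by
  have hpos : 0 < ε + ‖x‖ ^ 2 := by positivity
  have hgrad := norm_gradient_comp_norm hx (hasDerivAt_radial_profile (hg ‖x‖) hε
    (((N : ℝ) * ((N : ℝ) - 4) * ((N : ℝ) ^ 2 - 4) * ε ^ 2) ^ (((N : ℝ) - 4) / 8))
    (((N : ℝ) - 4) / 2))
  have he : cutBubble N g ε = fun y => g ‖y‖ *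
      (((N : ℝ) * ((N : ℝ) - 4) * ((N : ℝ) ^ 2 - 4) * ε ^ 2) ^ (((N : ℝ) - 4) / 8) /
        (ε + ‖y‖ ^ 2) ^ (((N : ℝ) - 4) / 2)) := rfl
  rw [he, hgrad, sq_abs, mul_pow, div_pow, sq_bubble_coeff hN hε, sq_rpow_half_sub hN hpos.le,
    slopeDefect, show N - 2 = N - 4 + 2 by omega, pow_add]
  field_simp
  ring

theorem integrable_one_add_sq_norm_inv_pow {N : ℕ} (hN : 7 ≤ N) :
    Integrable (fun x : EuclideanSpace ℝ (Fin N) => ((1 + ‖x‖ ^ 2) ^ (N - 3))⁻¹) := by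
  have hN' : (7 : ℝ) ≤ N := by exact_mod_cast hN
  have h := integrable_rpow_neg_one_add_norm_sq (E := EuclideanSpace ℝ (Fin N))
    (μ := volume) (r := 2 * ((N - 3 : ℕ) : ℝ)) (by
      rw [finrank_euclideanSpace_fin]
      push_cast [Nat.cast_sub (show 3 ≤ N by omega)]
      linarith)
  refine h.congr (ae_of_all _ fun x => ?_)
  have : 0 ≤ 1 + ‖x‖ ^ 2 := by positivity
  simp only
  rw [show -(2 * ((N - 3 : ℕ) : ℝ)) / 2 = -((N - 3 : ℕ) : ℝ) by ring, Real.rpow_neg this,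
    Real.rpow_natCast]

theorem integrable_sq_norm_div_one_add_sq_norm_pow {N : ℕ} (hN : 7 ≤ N) :
    Integrable (fun y : EuclideanSpace ℝ (Fin N) => ‖y‖ ^ 2 / (1 + ‖y‖ ^ 2) ^ (N - 2)) := by
  have hmeas : Measurable fun y : EuclideanSpace ℝ (Fin N) =>
      ‖y‖ ^ 2 / (1 + ‖y‖ ^ 2) ^ (N - 2) := by fun_prop
  refine (integrable_one_add_sq_norm_inv_pow hN).mono' hmeas.aestronglyMeasurable
    (ae_of_all _ fun y => ?_)
  rw [Real.norm_of_nonneg (by positivity), show N - 2 = N - 3 + 1 by omega,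
    pow_succ (1 + ‖y‖ ^ 2), div_le_iff₀ (by positivity), inv_mul_cancel_left₀ (by positivity)]
  linarith

theorem rescaled_slope_sq_eq {N : ℕ} (hN : 3 ≤ N) {ε : ℝ} (hε : 0 < ε)
    (x : EuclideanSpace ℝ (Fin N)) :
    ‖x‖ ^ 2 / (ε + ‖x‖ ^ 2) ^ (N - 2)
      = (ε ^ (N - 3))⁻¹ * (‖(√ε)⁻¹ • x‖ ^ 2 / (1 + ‖(√ε)⁻¹ • x‖ ^ 2) ^ (N - 2)) := by
  have h1 : ‖(√ε)⁻¹ • x‖ ^ 2 = ‖x‖ ^ 2 / ε := by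
    rw [norm_smul, mul_pow, norm_inv, inv_pow, Real.norm_of_nonneg (Real.sqrt_nonneg _),
      Real.sq_sqrt hε.le]
    ring
  have h2 : 1 + ‖x‖ ^ 2 / ε = (ε + ‖x‖ ^ 2) / ε := by field_simp
  have hpos : 0 < ε + ‖x‖ ^ 2 := by positivity
  rw [h1, h2, div_pow, show N - 2 = N - 3 + 1 by omega, pow_succ ε]
  field_simp

theorem integrable_sq_norm_div_add_sq_norm_pow {N : ℕ} (hN : 7 ≤ N) {ε : ℝ} (hε : 0 < ε) :
    Integrable (fun x : EuclideanSpace ℝ (Fin N) => ‖x‖ ^ 2 / (ε + ‖x‖ ^ 2) ^ (N - 2)) := by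
  simp_rw [rescaled_slope_sq_eq (show 3 ≤ N by omega) hε]
  exact ((integrable_sq_norm_div_one_add_sq_norm_pow hN).comp_smul
    (inv_ne_zero (Real.sqrt_pos.2 hε).ne')).const_mul _

theorem rpow_mul_integral_sq_norm_div {N : ℕ} (hN : 3 ≤ N) {ε : ℝ} (hε : 0 < ε) :
    ε ^ (((N : ℝ) - 4) / 2) *
        (∫ x : EuclideanSpace ℝ (Fin N), ‖x‖ ^ 2 / (ε + ‖x‖ ^ 2) ^ (N - 2))
      = ε * ∫ y : EuclideanSpace ℝ (Fin N), ‖y‖ ^ 2 / (1 + ‖y‖ ^ 2) ^ (N - 2) := by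
  simp_rw [rescaled_slope_sq_eq hN hε]
  rw [integral_const_mul, Measure.integral_comp_smul volume
    (fun y : EuclideanSpace ℝ (Fin N) => ‖y‖ ^ 2 / (1 + ‖y‖ ^ 2) ^ (N - 2)),
    finrank_euclideanSpace_fin, smul_eq_mul, ← mul_assoc, ← mul_assoc]
  congr 1
  rw [inv_pow, inv_inv, abs_of_nonneg (by positivity), Real.sqrt_eq_rpow, ← Real.rpow_natCast,
    ← Real.rpow_natCast, ← Real.rpow_mul hε.le, ← Real.rpow_neg hε.le, ← Real.rpow_add hε,
    ← Real.rpow_add hε]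
  push_cast [Nat.cast_sub hN]
  ring_nf
  exact Real.rpow_one ε

theorem exists_abs_deriv_mul_le_of_eq_zero {g : ℝ → ℝ} (hg : ContDiff ℝ 1 g) {R : ℝ}
    (hg0 : ∀ r, R ≤ r → g r = 0) : ∃ M, 0 ≤ M ∧ ∀ r, 0 ≤ r → |deriv g r * r| ≤ M := by
  have hcont : Continuous fun r => deriv g r * r := (hg.continuous_deriv le_rfl).mul continuous_id
  obtain ⟨M, hM⟩ := (isCompact_Icc (a := (0 : ℝ)) (b := R)).exists_bound_of_continuousOn
    hcont.continuousOn
  refine ⟨max M 0, le_max_right _ _, fun r hr => ?_⟩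
  rcases le_or_gt r R with h | h
  · exact (hM r ⟨hr, h⟩).trans (le_max_left _ _)
  · have : g =ᶠ[𝓝 r] fun _ => 0 := by
      filter_upwards [Ioi_mem_nhds h] with t ht using hg0 t (le_of_lt ht)
    simp [this.deriv_eq]

theorem slopeDefect_eq_zero {N : ℕ} {g : ℝ → ℝ} {ε ρ r : ℝ} (hg1 : ∀ t, 0 ≤ t → t ≤ ρ → g t = 1)
    (hr0 : 0 < r) (hr : r < ρ) : slopeDefect N g ε r = 0 := by
  have : g =ᶠ[𝓝 r] fun _ => 1 := by
    filter_upwards [Ioo_mem_nhds hr0 hr] with t ht using hg1 t ht.1.le ht.2.le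
  simp [slopeDefect, this.deriv_eq, this.eq_of_nhds]

theorem abs_slopeDefect_le {N : ℕ} (hN : 4 ≤ N) {g : ℝ → ℝ} {ε ρ r M : ℝ} (hε : 0 < ε)
    (hρ : 0 < ρ) (hr : ρ ≤ r) (hg : g r ∈ Set.Icc (0 : ℝ) 1) (hM : |deriv g r * r| ≤ M) :
    |slopeDefect N g ε r| ≤ ((M + (N - 4)) ^ 2 + (N - 4) ^ 2) *
      ((1 + ρ ^ 2) / ρ ^ 2) ^ (N - 3) * ((1 + r ^ 2) ^ (N - 3))⁻¹ := by
  have hr0 : 0 < r := hρ.trans_le hr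
  have hN' : (0 : ℝ) ≤ N - 4 := sub_nonneg.2 (by exact_mod_cast hN)
  have hq : 0 < r ^ 2 := by positivity
  have hfrac : r ^ 2 / (ε + r ^ 2) ≤ 1 := by
    rw [div_le_one (by positivity)]; linarith
  have hfrac0 : 0 ≤ r ^ 2 / (ε + r ^ 2) := by positivity
  set b : ℝ := r ^ 2 / (ε + r ^ 2) with hb
  have hgb : g r * b ≤ 1 := mul_le_one₀ hg.2 hfrac0 hfrac
  have hgb0 : 0 ≤ g r * b := mul_nonneg hg.1 hfrac0
  have hnum : (deriv g r - ((N : ℝ) - 4) * g r * r / (ε + r ^ 2)) ^ 2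
      - (((N : ℝ) - 4) * r / (ε + r ^ 2)) ^ 2
      = ((deriv g r * r - (N - 4) * (g r * b)) ^ 2 - ((N - 4) * b) ^ 2) / r ^ 2 := by
    rw [hb]; field_simp
  have habs : |(deriv g r * r - (N - 4) * (g r * b)) ^ 2 - ((N - 4) * b) ^ 2|
      ≤ (M + (N - 4)) ^ 2 + (N - 4) ^ 2 := by
    have h1 : |deriv g r * r - (N - 4) * (g r * b)| ≤ M + (N - 4) := by
      refine (abs_sub _ _).trans (add_le_add hM ?_)
      rw [abs_of_nonneg (mul_nonneg hN' hgb0)]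
      exact mul_le_of_le_one_right hN' hgb
    have h2 : |((N : ℝ) - 4) * b| ≤ N - 4 := by
      rw [abs_of_nonneg (mul_nonneg hN' hfrac0)]
      exact mul_le_of_le_one_right hN' hfrac
    refine (abs_sub _ _).trans (add_le_add ?_ ?_)
    · rw [abs_pow]; gcongr
    · rw [abs_pow]; gcongr
  rw [slopeDefect, hnum, div_div, abs_div, mul_assoc, abs_of_pos (a := r ^ 2 * _) (by positivity),
    div_eq_mul_inv]
  refine mul_le_mul habs ?_ (by positivity) (by positivity)
  rw [← div_eq_mul_inv, ← div_pow, inv_le_comm₀ (by positivity) (by positivity), ← inv_pow]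
  have h3 : ((1 + ρ ^ 2) / ρ ^ 2 / (1 + r ^ 2))⁻¹ ≤ r ^ 2 := by
    have hle : ρ ^ 2 ≤ r ^ 2 := by gcongr
    rw [div_div, inv_div, div_le_iff₀ (by positivity)]
    nlinarith
  calc ((1 + ρ ^ 2) / ρ ^ 2 / (1 + r ^ 2))⁻¹ ^ (N - 3) ≤ (r ^ 2) ^ (N - 3) := by gcongr
    _ = r ^ 2 * (r ^ 2) ^ (N - 4) := by rw [← pow_succ', show N - 4 + 1 = N - 3 by omega]
    _ ≤ r ^ 2 * (ε + r ^ 2) ^ (N - 4) := by gcongr; linarith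

/-- For `N ≥ 8`: `∫ |∇V_ε|² = C_N K₁ ε + O(ε^{(N−4)/2})` as `ε → 0⁺`, where
`C_N = c_N (N−4)²`, `c_N = (N(N−4)(N²−4))^{(N−4)/4}` and
`K₁ = ∫_{ℝ^N} |y|²/(1+|y|²)^{N−2} dy`. -/
theorem cutBubble_gradient_estimate_high_dim (N : ℕ) (hN : 8 ≤ N) (ρ : ℝ) (hρ : 0 < ρ)
    (g : ℝ → ℝ) (hg : ContDiff ℝ (⊤ : ℕ∞) g)
    (hg01 : ∀ r : ℝ, 0 ≤ r → g r ∈ Set.Icc (0 : ℝ) 1)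
    (hg1 : ∀ r : ℝ, 0 ≤ r → r ≤ ρ → g r = 1)
    (hg0 : ∀ r : ℝ, 2 * ρ ≤ r → g r = 0)
    (CN K₁ : ℝ)
    (hCN : CN = ((N : ℝ) * ((N : ℝ) - 4) * ((N : ℝ) ^ 2 - 4)) ^ (((N : ℝ) - 4) / 4)
      * ((N : ℝ) - 4) ^ 2)
    (hK₁ : K₁ = ∫ y : EuclideanSpace ℝ (Fin N), ‖y‖ ^ 2 / (1 + ‖y‖ ^ 2) ^ (N - 2)) :
    (fun ε : ℝ =>
        (∫ x : EuclideanSpace ℝ (Fin N), ‖gradient (cutBubble N g ε) x‖ ^ 2)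
          - CN * K₁ * ε)
      =O[𝓝[>] (0 : ℝ)] (fun ε : ℝ => ε ^ (((N : ℝ) - 4) / 2)) := by
  have hg1' : ContDiff ℝ 1 g := hg.of_le (by exact_mod_cast le_top)
  obtain ⟨M, hM0, hM⟩ := exists_abs_deriv_mul_le_of_eq_zero hg1' hg0
  set A : ℝ := ((N : ℝ) * ((N : ℝ) - 4) * ((N : ℝ) ^ 2 - 4)) ^ (((N : ℝ) - 4) / 4) with hA
  set B : ℝ := ((M + (N - 4)) ^ 2 + (N - 4) ^ 2) * ((1 + ρ ^ 2) / ρ ^ 2) ^ (N - 3) with hB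
  have hN0 : Nontrivial (EuclideanSpace ℝ (Fin N)) := by
    have : Nonempty (Fin N) := ⟨⟨0, by omega⟩⟩
    infer_instance
  have hne : ∀ᵐ x : EuclideanSpace ℝ (Fin N), x ≠ 0 := by
    simp [ae_iff]
  have hbound : ∀ ε : ℝ, 0 < ε → ∀ᵐ x : EuclideanSpace ℝ (Fin N),
      ‖slopeDefect N g ε ‖x‖‖ ≤ B * ((1 + ‖x‖ ^ 2) ^ (N - 3))⁻¹ := by
    intro ε hε
    filter_upwards [hne] with x hx
    rcases lt_or_ge ‖x‖ ρ with h | h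
    · rw [slopeDefect_eq_zero hg1 (norm_pos_iff.2 hx) h, norm_zero]
      positivity
    · exact abs_slopeDefect_le (by omega) hε hρ h (hg01 _ (norm_nonneg _)) (hM _ (norm_nonneg _))
  have hint := (integrable_one_add_sq_norm_inv_pow (show 7 ≤ N by omega)).const_mul B
  refine IsBigO.of_bound
    (|A| * ∫ x : EuclideanSpace ℝ (Fin N), B * ((1 + ‖x‖ ^ 2) ^ (N - 3))⁻¹) ?_
  filter_upwards [self_mem_nhdsWithin] with ε hε
  replace hε : 0 < ε := hε
  have hmeas : Measurable fun x : EuclideanSpace ℝ (Fin N) => slopeDefect N g ε ‖x‖ := by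
    have hgm : Measurable g := hg.continuous.measurable
    have hdm : Measurable (deriv g) := measurable_deriv g
    unfold slopeDefect
    fun_prop
  have hdint : Integrable fun x : EuclideanSpace ℝ (Fin N) => slopeDefect N g ε ‖x‖ :=
    hint.mono' hmeas.aestronglyMeasurable (hbound ε hε)
  have hgrad : ∫ x : EuclideanSpace ℝ (Fin N), ‖gradient (cutBubble N g ε) x‖ ^ 2
      = ∫ x : EuclideanSpace ℝ (Fin N), A * ε ^ (((N : ℝ) - 4) / 2)
        * (((N : ℝ) - 4) ^ 2 * (‖x‖ ^ 2 / (ε + ‖x‖ ^ 2) ^ (N - 2)) + slopeDefect N g ε ‖x‖) := by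
    refine integral_congr_ae ?_
    filter_upwards [hne] with x hx
    exact sq_norm_gradient_cutBubble (by omega) (hg1'.differentiable one_ne_zero) hε hx
  have hdiff : (∫ x : EuclideanSpace ℝ (Fin N), ‖gradient (cutBubble N g ε) x‖ ^ 2) - CN * K₁ * ε
      = A * (∫ x : EuclideanSpace ℝ (Fin N), slopeDefect N g ε ‖x‖)
        * ε ^ (((N : ℝ) - 4) / 2) := by
    rw [hgrad, integral_const_mul, integral_add
      ((integrable_sq_norm_div_add_sq_norm_pow (by omega) hε).const_mul _) hdint,
      integral_const_mul, hCN, hK₁]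
    linear_combination A * ((N : ℝ) - 4) ^ 2 *
      rpow_mul_integral_sq_norm_div (show 3 ≤ N by omega) hε
  rw [hdiff, norm_mul, norm_mul, Real.norm_eq_abs A]
  gcongr
  exact norm_integral_le_of_norm_le hint (hbound ε hε)
end

section
/- Let N = 6. Then ∫_{ℝ^6} |∇V_ε(x)|² dx = 2 c₆ ω₆ ε log(1/ε) + O(ε) as ε → 0⁺, where c₆ = (6·2·32)^{1/2} = (6(6−4)(6²−4))^{(6−4)/4} and ω₆ is the surface area of the unit sphere in ℝ⁶. -/
open MeasureTheory Real Filter Asymptotics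
open scoped Topology

/-- The gradient of a radial function has norm the absolute value of the radial derivative. -/
theorem norm_gradient_comp_norm_s10 {E : Type*} [NormedAddCommGroup E] [InnerProductSpace ℝ E]
    [CompleteSpace E] {F : ℝ → ℝ} {F' : ℝ} {x : E} (hx : x ≠ 0) (hF : HasDerivAt F F' ‖x‖) :
    ‖gradient (fun y : E => F ‖y‖) x‖ = |F'| := by
  have : Nontrivial E := ⟨x, 0, hx⟩
  have hd : DifferentiableAt ℝ (fun y : E => ‖y‖) x :=
    (contDiffAt_norm ℝ hx).differentiableAt one_ne_zero
  have hc : HasFDerivAt (fun y : E => F ‖y‖) (F' • fderiv ℝ (fun y : E => ‖y‖) x) x :=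
    hF.comp_hasFDerivAt x hd.hasFDerivAt
  rw [gradient, LinearIsometryEquiv.norm_map, hc.fderiv, norm_smul, norm_fderiv_norm hd, mul_one,
    Real.norm_eq_abs]

/-- The derivative of the cut-off profile `r ↦ g r / (ε + r²)`. -/
theorem hasDerivAt_div_add_sq {g : ℝ → ℝ} (hg : Differentiable ℝ g) {ε : ℝ} (hε : 0 < ε) (r : ℝ) :
    HasDerivAt (fun s => g s / (ε + s ^ 2))
      (deriv g r / (ε + r ^ 2) - 2 * r * g r / (ε + r ^ 2) ^ 2) r := by
  have h0 : ε + r ^ 2 ≠ 0 := by positivity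
  have h1 : HasDerivAt (fun s : ℝ => ε + s ^ 2) (2 * r) r := by
    simpa using (hasDerivAt_pow 2 r).const_add ε
  refine ((hg r).hasDerivAt.div h1 h0).congr_deriv ?_
  field_simp

/-- In dimension six the Dirichlet energy of the cut-off bubble is a one-dimensional integral. -/
theorem integral_norm_gradient_cutBubble_six {g : ℝ → ℝ} (hg : Differentiable ℝ g) {ε : ℝ}
    (hε : 0 < ε) :
    ∫ x : EuclideanSpace ℝ (Fin 6), ‖gradient (cutBubble 6 g ε) x‖ ^ 2 =
      ((6 : ℝ) * ((6 : ℝ) - 4) * ((6 : ℝ) ^ 2 - 4)) ^ (((6 : ℝ) - 4) / 4) * ε * sphereArea 6 *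
        ∫ r in Set.Ioi (0 : ℝ),
          r ^ 5 * (deriv g r / (ε + r ^ 2) - 2 * r * g r / (ε + r ^ 2) ^ 2) ^ 2 := by
  set K : ℝ := (6 : ℝ) * ((6 : ℝ) - 4) * ((6 : ℝ) ^ 2 - 4) with hK
  have hK0 : 0 < K := by rw [hK]; norm_num
  set A : ℝ := (K * ε ^ 2) ^ (((6 : ℝ) - 4) / 8) with hA
  have hA2 : A ^ 2 = K ^ (((6 : ℝ) - 4) / 4) * ε := by
    rw [hA, ← Real.rpow_natCast, ← Real.rpow_mul (by positivity),
      Real.mul_rpow hK0.le (by positivity), ← Real.rpow_natCast ε 2, ← Real.rpow_mul hε.le]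
    norm_num
  have hcut : cutBubble 6 g ε =
      fun x : EuclideanSpace ℝ (Fin 6) => (fun r => A * (g r / (ε + r ^ 2))) ‖x‖ := by
    funext x
    have h1 : (((6 : ℕ) : ℝ) - 4) / 2 = 1 := by norm_num
    rw [cutBubble, bubble, h1, Real.rpow_one]
    push_cast
    rw [← hK, ← hA]
    ring
  have hae : (fun x : EuclideanSpace ℝ (Fin 6) => ‖gradient (cutBubble 6 g ε) x‖ ^ 2) =ᵐ[volume]
      fun x => (fun r => A ^ 2 *
        (deriv g r / (ε + r ^ 2) - 2 * r * g r / (ε + r ^ 2) ^ 2) ^ 2) ‖x‖ := by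
    filter_upwards [Measure.ae_ne volume 0] with x hx
    rw [hcut, norm_gradient_comp_norm_s10 hx ((hasDerivAt_div_add_sq hg hε ‖x‖).const_mul A), sq_abs,
      mul_pow]
  rw [integral_congr_ae hae, integral_fun_norm_addHaar volume (fun r => A ^ 2 *
    (deriv g r / (ε + r ^ 2) - 2 * r * g r / (ε + r ^ 2) ^ 2) ^ 2), hA2, sphereArea, measureReal_def,
    finrank_euclideanSpace_fin]
  simp only [nsmul_eq_mul, smul_eq_mul, Nat.add_one_sub_one]
  have hmul : ∀ y : ℝ, y ^ 5 * (K ^ (((6 : ℝ) - 4) / 4) * ε *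
      (deriv g y / (ε + y ^ 2) - 2 * y * g y / (ε + y ^ 2) ^ 2) ^ 2) =
      K ^ (((6 : ℝ) - 4) / 4) * ε * (y ^ 5 *
      (deriv g y / (ε + y ^ 2) - 2 * y * g y / (ε + y ^ 2) ^ 2) ^ 2) := fun y => by ring
  simp only [hmul, integral_const_mul]
  ring

/-- The logarithmically divergent integral governing the energy near the origin. -/
theorem integral_pow_seven_div_add_sq {ε ρ : ℝ} (hε : 0 < ε) :
    ∫ r in (0 : ℝ)..ρ, 4 * r ^ 7 / (ε + r ^ 2) ^ 4 =
      2 * (Real.log (ε + ρ ^ 2) + 3 * (ε / (ε + ρ ^ 2)) - 3 / 2 * (ε / (ε + ρ ^ 2)) ^ 2 +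
        1 / 3 * (ε / (ε + ρ ^ 2)) ^ 3) - 2 * (Real.log ε + 11 / 6) := by
  have hpos : ∀ r : ℝ, 0 < ε + r ^ 2 := fun r => by positivity
  have hder : ∀ r : ℝ, HasDerivAt (fun r : ℝ => 2 * (Real.log (ε + r ^ 2) + 3 * (ε / (ε + r ^ 2)) -
      3 / 2 * (ε / (ε + r ^ 2)) ^ 2 + 1 / 3 * (ε / (ε + r ^ 2)) ^ 3))
      (4 * r ^ 7 / (ε + r ^ 2) ^ 4) r := by
    intro r
    have h1 : HasDerivAt (fun s : ℝ => ε + s ^ 2) (2 * r) r := by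
      simpa using (hasDerivAt_pow 2 r).const_add ε
    have hq := (hasDerivAt_const r ε).div h1 (hpos r).ne'
    refine (((((h1.log (hpos r).ne').add (hq.const_mul 3)).sub
      ((hq.pow 2).const_mul (3 / 2))).add
      ((hq.pow 3).const_mul (1 / 3))).const_mul 2).congr_deriv ?_
    have := (hpos r).ne'
    simp only [Pi.div_apply, Nat.reduceSub, Nat.cast_ofNat]
    field_simp
    ring
  rw [intervalIntegral.integral_eq_sub_of_hasDerivAt (fun r _ => hder r)]
  · simp only [ne_eq, OfNat.ofNat_ne_zero, not_false_eq_true, zero_pow, add_zero, div_self hε.ne']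
    ring
  · refine Continuous.intervalIntegrable ?_ _ _
    exact Continuous.div (by fun_prop) (by fun_prop) fun r => (pow_pos (hpos r) 4).ne'

/-- The one-dimensional energy of the cut-off profile is `2 log (1 / ε) + O(1)`. -/
theorem isBigO_radial_energy_sub_log {ρ : ℝ} (hρ : 0 < ρ) {g : ℝ → ℝ} (hg : ContDiff ℝ 1 g)
    (hg1 : ∀ r : ℝ, 0 ≤ r → r ≤ ρ → g r = 1) (hg0 : ∀ r : ℝ, 2 * ρ ≤ r → g r = 0) :
    (fun ε : ℝ => (∫ r in Set.Ioi (0 : ℝ),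
        r ^ 5 * (deriv g r / (ε + r ^ 2) - 2 * r * g r / (ε + r ^ 2) ^ 2) ^ 2) -
          2 * Real.log (1 / ε)) =O[𝓝[>] (0 : ℝ)] (fun _ => (1 : ℝ)) := by
  have hg' : Continuous (deriv g) := hg.continuous_deriv le_rfl
  have hgc : Continuous g := hg.continuous
  have hd1 : ∀ r ∈ Set.Ioo 0 ρ, deriv g r = 0 := fun r hr => by
    have : g =ᶠ[𝓝 r] fun _ => 1 := by
      filter_upwards [Ioo_mem_nhds hr.1 hr.2] with s hs using hg1 s hs.1.le hs.2.le
    rw [this.deriv_eq, deriv_const]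
  have hd0 : ∀ r ∈ Set.Ioi (2 * ρ), deriv g r = 0 := fun r hr => by
    have : g =ᶠ[𝓝 r] fun _ => 0 := by
      filter_upwards [Ioi_mem_nhds hr] with s hs using hg0 s (le_of_lt hs)
    rw [this.deriv_eq, deriv_const]
  obtain ⟨M, hM⟩ := isCompact_Icc.exists_bound_of_continuousOn (s := Set.Icc ρ (2 * ρ))
    hg'.continuousOn
  obtain ⟨L, hL⟩ := isCompact_Icc.exists_bound_of_continuousOn (s := Set.Icc ρ (2 * ρ))
    hgc.continuousOn
  set H : ℝ → ℝ → ℝ := fun ε r =>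
    r ^ 5 * (deriv g r / (ε + r ^ 2) - 2 * r * g r / (ε + r ^ 2) ^ 2) ^ 2 with hH
  set B : ℝ := (2 * ρ) ^ 5 * (M / ρ ^ 2 + 2 * (2 * ρ) * L / (ρ ^ 2) ^ 2) ^ 2 with hB
  have hsplit : ∀ ε : ℝ, 0 < ε → ∫ r in Set.Ioi (0 : ℝ), H ε r =
      (∫ r in (0 : ℝ)..ρ, 4 * r ^ 7 / (ε + r ^ 2) ^ 4) + ∫ r in ρ..(2 * ρ), H ε r := by
    intro ε hε
    have hc : Continuous (H ε) := by
      have hpos : ∀ r : ℝ, 0 < ε + r ^ 2 := fun r => by positivity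
      exact (continuous_pow 5).mul (((hg'.div (by fun_prop) fun r => (hpos r).ne').sub
        (Continuous.div (by fun_prop) (by fun_prop) fun r => (pow_pos (hpos r) 2).ne')).pow 2)
    have h1 : ∫ r in (0 : ℝ)..ρ, 4 * r ^ 7 / (ε + r ^ 2) ^ 4 = ∫ r in (0 : ℝ)..ρ, H ε r := by
      rw [intervalIntegral.integral_of_le hρ.le, intervalIntegral.integral_of_le hρ.le,
        integral_Ioc_eq_integral_Ioo, integral_Ioc_eq_integral_Ioo]
      refine setIntegral_congr_fun measurableSet_Ioo fun r hr => ?_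
      simp only [hH, hd1 r hr, hg1 r hr.1.le hr.2.le]
      rw [zero_div, zero_sub, neg_sq, div_pow, ← pow_mul, mul_div_assoc']
      ring
    rw [h1, intervalIntegral.integral_add_adjacent_intervals (hc.intervalIntegrable _ _)
      (hc.intervalIntegrable _ _), intervalIntegral.integral_of_le (by positivity)]
    refine (setIntegral_eq_of_subset_of_forall_sdiff_eq_zero measurableSet_Ioi
      Set.Ioc_subset_Ioi_self fun r hr => ?_)
    have hr2 : 2 * ρ < r := by
      by_contra! h
      exact hr.2 ⟨hr.1, h⟩
    simp [hH, hd0 r hr2, hg0 r hr2.le]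
  have hmid : ∀ ε : ℝ, 0 < ε → |∫ r in ρ..(2 * ρ), H ε r| ≤ B * ρ := by
    intro ε hε
    have h := intervalIntegral.norm_integral_le_of_norm_le_const (a := ρ) (b := 2 * ρ) (C := B)
      (f := H ε) fun r hr => ?_
    · rwa [Real.norm_eq_abs, show 2 * ρ - ρ = ρ by ring, abs_of_pos hρ] at h
    rw [Set.uIoc_of_le (by linarith)] at hr
    have hr' : r ∈ Set.Icc ρ (2 * ρ) := Set.Ioc_subset_Icc_self hr
    have hr0 : 0 < r := hρ.trans hr.1
    have hden : ρ ^ 2 ≤ ε + r ^ 2 := by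
      have := pow_le_pow_left₀ hρ.le hr'.1 2
      linarith
    have hM0 : 0 ≤ M := (norm_nonneg _).trans (hM r hr')
    have hL0 : 0 ≤ L := (norm_nonneg _).trans (hL r hr')
    have ht1 : |deriv g r / (ε + r ^ 2)| ≤ M / ρ ^ 2 := by
      rw [abs_div, abs_of_pos (by positivity : 0 < ε + r ^ 2)]
      exact div_le_div₀ hM0 (hM r hr') (by positivity) hden
    have ht2 : |2 * r * g r / (ε + r ^ 2) ^ 2| ≤ 2 * (2 * ρ) * L / (ρ ^ 2) ^ 2 := by
      rw [abs_div, abs_mul, abs_of_pos (by positivity : 0 < (ε + r ^ 2) ^ 2),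
        abs_of_pos (by positivity : 0 < 2 * r)]
      refine div_le_div₀ (by positivity) (mul_le_mul ?_ (hL r hr') (abs_nonneg _) (by positivity))
        (by positivity) (pow_le_pow_left₀ (by positivity) hden 2)
      linarith [hr'.2]
    simp only [hH, hB]
    rw [norm_mul, norm_pow, norm_pow, Real.norm_eq_abs, Real.norm_eq_abs, abs_of_pos hr0]
    have ht := (abs_sub _ _).trans (add_le_add ht1 ht2)
    gcongr
    exact hr'.2
  have hO1 : (fun ε : ℝ => ∫ r in ρ..(2 * ρ), H ε r) =O[𝓝[>] (0 : ℝ)] (fun _ => (1 : ℝ)) := by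
    refine IsBigO.of_bound (B * ρ) ?_
    filter_upwards [self_mem_nhdsWithin] with ε hε
    simpa using hmid ε hε
  have hO2 : (fun ε : ℝ => 2 * (Real.log (ε + ρ ^ 2) + 3 * (ε / (ε + ρ ^ 2)) -
      3 / 2 * (ε / (ε + ρ ^ 2)) ^ 2 + 1 / 3 * (ε / (ε + ρ ^ 2)) ^ 3) - 11 / 3)
      =O[𝓝[>] (0 : ℝ)] (fun _ => (1 : ℝ)) := by
    have hne : (0 : ℝ) + ρ ^ 2 ≠ 0 := by positivity
    refine (ContinuousAt.tendsto ?_).mono_left nhdsWithin_le_nhds |>.isBigO_one ℝ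
    fun_prop (disch := assumption)
  refine (hO1.add hO2).congr' ?_ EventuallyEq.rfl
  filter_upwards [self_mem_nhdsWithin] with ε hε
  rw [hsplit ε hε, integral_pow_seven_div_add_sq hε, one_div ε, Real.log_inv]
  ring

/-- For `N = 6`: `∫ |∇V_ε|² = 2 c₆ ω₆ ε log(1/ε) + O(ε)` as `ε → 0⁺`, where
`c₆ = (6(6−4)(6²−4))^{(6−4)/4}` and `ω₆` is the area of the unit sphere in `ℝ⁶`. -/
theorem cutBubble_gradient_estimate_dim6 (ρ : ℝ) (hρ : 0 < ρ)
    (g : ℝ → ℝ) (hg : ContDiff ℝ (⊤ : ℕ∞) g)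
    (hg01 : ∀ r : ℝ, 0 ≤ r → g r ∈ Set.Icc (0 : ℝ) 1)
    (hg1 : ∀ r : ℝ, 0 ≤ r → r ≤ ρ → g r = 1)
    (hg0 : ∀ r : ℝ, 2 * ρ ≤ r → g r = 0)
    (c₆ : ℝ)
    (hc₆ : c₆ = ((6 : ℝ) * ((6 : ℝ) - 4) * ((6 : ℝ) ^ 2 - 4)) ^ (((6 : ℝ) - 4) / 4)) :
    (fun ε : ℝ =>
        (∫ x : EuclideanSpace ℝ (Fin 6), ‖gradient (cutBubble 6 g ε) x‖ ^ 2)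
          - 2 * c₆ * sphereArea 6 * ε * Real.log (1 / ε))
      =O[𝓝[>] (0 : ℝ)] (fun ε : ℝ => ε) := by
  have hmain := ((isBigO_radial_energy_sub_log hρ (hg.of_le (by exact_mod_cast le_top)) hg1
    hg0).const_mul_left (c₆ * sphereArea 6)).mul (isBigO_refl (fun ε : ℝ => ε) (𝓝[>] (0 : ℝ)))
  refine hmain.congr' ?_ (Eventually.of_forall fun ε => one_mul ε)
  filter_upwards [self_mem_nhdsWithin] with ε hε
  rw [integral_norm_gradient_cutBubble_six (hg.differentiable (by simp)) hε, ← hc₆]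
  ring
end

section
/- Let N = 5. Then ∫_{ℝ^5} |∇V_ε(x)|² dx = O(ε^{1/2}) as ε → 0⁺. -/
open MeasureTheory Real Filter Asymptotics
open scoped Topology

/-- If a radial profile `F` has derivative `c` at `‖x‖`, the gradient of `F ∘ ‖·‖` at `x ≠ 0` has
norm at most `|c|`. -/
theorem norm_gradient_comp_norm_le {E : Type*} [NormedAddCommGroup E] [InnerProductSpace ℝ E]
    [CompleteSpace E] {F : ℝ → ℝ} {c : ℝ} {x : E} (hx : x ≠ 0) (hF : HasDerivAt F c ‖x‖) :
    ‖gradient (fun y => F ‖y‖) x‖ ≤ |c| := by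
  have hn : HasFDerivAt (fun y : E => ‖y‖) (fderiv ℝ (fun y : E => ‖y‖) x) x :=
    ((contDiffAt_norm ℝ hx (n := 1)).differentiableAt (by norm_num)).hasFDerivAt
  have h1 : ‖fderiv ℝ (fun y : E => ‖y‖) x‖ ≤ 1 := by
    simpa using norm_fderiv_le_of_lipschitz ℝ (lipschitzWith_one_norm (E := E)) (x₀ := x)
  have h2 : fderiv ℝ (fun y => F ‖y‖) x = c • fderiv ℝ (fun y : E => ‖y‖) x :=
    (hF.comp_hasFDerivAt x hn).fderiv
  rw [gradient, LinearIsometryEquiv.norm_map, h2, norm_smul, Real.norm_eq_abs]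
  exact mul_le_of_le_one_right (abs_nonneg c) h1

/-- `|x|⁻⁴` is integrable on balls of `ℝ⁵`. -/
theorem integrable_indicator_norm_inv_pow_four (R : ℝ) :
    Integrable (fun x : EuclideanSpace ℝ (Fin 5) =>
      (Set.Iic R).indicator (fun r : ℝ => (r ^ 4)⁻¹) ‖x‖) := by
  rw [integrable_fun_norm_addHaar volume (f := (Set.Iic R).indicator (fun r : ℝ => (r ^ 4)⁻¹))]
  have h : IntegrableOn ((Set.Iic R).indicator (fun _ : ℝ => (1 : ℝ))) (Set.Ioi 0) := by
    rw [IntegrableOn, integrable_indicator_iff measurableSet_Iic, IntegrableOn,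
      Measure.restrict_restrict measurableSet_Iic, Set.inter_comm, Set.Ioi_inter_Iic]
    exact integrableOn_const (by simp)
  refine h.congr_fun (fun r hr => ?_) measurableSet_Ioi
  have hr0 : r ≠ 0 := (Set.mem_Ioi.1 hr).ne'
  by_cases hR : r ∈ Set.Iic R
  · simp [Set.indicator_of_mem hR, hr0]
  · simp [Set.indicator_of_notMem hR]

/-- The derivative of the radial profile `A g(r) / √(ε + r²)`. -/
theorem hasDerivAt_cutBubble_profile {g : ℝ → ℝ} {g' r ε A : ℝ} (hg : HasDerivAt g g' r)
    (hε : 0 < ε) :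
    HasDerivAt (fun t => g t * (A / √(ε + t ^ 2)))
      (A * (g' / √(ε + r ^ 2) - g r * r / √(ε + r ^ 2) ^ 3)) r := by
  have hs : 0 < ε + r ^ 2 := by positivity
  have hs' : √(ε + r ^ 2) ≠ 0 := (Real.sqrt_pos.2 hs).ne'
  have h1 : HasDerivAt (fun t : ℝ => ε + t ^ 2) (2 * r) r := by
    simpa using (hasDerivAt_pow 2 r).const_add ε
  refine (hg.mul ((hasDerivAt_const r A).div (h1.sqrt hs.ne') hs')).congr_deriv ?_
  simp only [Pi.div_apply]
  field_simp
  ring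

/-- Pointwise bound of the derivative of the radial profile, uniform in `ε`. -/
theorem abs_deriv_cutBubble_profile_le {a b r ε A M R : ℝ} (hr : 0 < r) (hrR : r ≤ R)
    (hε : 0 < ε) (hA : 0 ≤ A) (ha : |a| ≤ M) (hb : |b| ≤ 1) :
    |A * (a / √(ε + r ^ 2) - b * r / √(ε + r ^ 2) ^ 3)| ≤ A * (M * R + 1) * (r ^ 2)⁻¹ := by
  have hrs : r ≤ √(ε + r ^ 2) := Real.le_sqrt_of_sq_le (by linarith)
  set s := √(ε + r ^ 2)
  have hs : 0 < s := hr.trans_le hrs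
  have hM : 0 ≤ M := (abs_nonneg a).trans ha
  have h1 : |a / s| ≤ M * R * (r ^ 2)⁻¹ := by
    rw [abs_div, abs_of_pos hs]
    calc |a| / s ≤ M / r := by gcongr
      _ = M * r * (r ^ 2)⁻¹ := by field_simp
      _ ≤ M * R * (r ^ 2)⁻¹ := by gcongr
  have h2 : |b * r / s ^ 3| ≤ (r ^ 2)⁻¹ := by
    rw [abs_div, abs_mul, abs_of_pos hr, abs_of_pos (pow_pos hs 3)]
    calc |b| * r / s ^ 3 ≤ 1 * r / r ^ 3 := by gcongr
      _ = (r ^ 2)⁻¹ := by field_simp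
  rw [abs_mul, abs_of_nonneg hA, mul_assoc]
  gcongr
  linarith [abs_sub (a / s) (b * r / s ^ 3)]

theorem cutBubble_five_eq (g : ℝ → ℝ) (ε : ℝ) :
    cutBubble 5 g ε =
      fun x => (fun t => g t * ((105 * ε ^ 2) ^ ((1 : ℝ) / 8) / √(ε + t ^ 2))) ‖x‖ := by
  funext x
  simp only [cutBubble, bubble, Real.sqrt_eq_rpow]
  norm_num

/-- For `N = 5`: `∫ |∇V_ε|² = O(ε^{1/2})` as `ε → 0⁺`. -/
theorem cutBubble_gradient_estimate_dim5 (ρ : ℝ) (hρ : 0 < ρ)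
    (g : ℝ → ℝ) (hg : ContDiff ℝ (⊤ : ℕ∞) g)
    (hg01 : ∀ r : ℝ, 0 ≤ r → g r ∈ Set.Icc (0 : ℝ) 1)
    (hg1 : ∀ r : ℝ, 0 ≤ r → r ≤ ρ → g r = 1)
    (hg0 : ∀ r : ℝ, 2 * ρ ≤ r → g r = 0) :
    (fun ε : ℝ => ∫ x : EuclideanSpace ℝ (Fin 5), ‖gradient (cutBubble 5 g ε) x‖ ^ 2)
      =O[𝓝[>] (0 : ℝ)] (fun ε : ℝ => ε ^ ((1 : ℝ) / 2)) := by
  have hdiff : Differentiable ℝ g := hg.differentiable (by simp)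
  obtain ⟨M, hM⟩ := (isCompact_Icc (a := (0 : ℝ)) (b := 2 * ρ)).exists_bound_of_continuousOn
    (hg.continuous_deriv (by simp)).continuousOn
  set I := (Set.Iic (2 * ρ)).indicator (fun r : ℝ => (r ^ 4)⁻¹) with hI
  have hint : Integrable (fun x : EuclideanSpace ℝ (Fin 5) => I ‖x‖) :=
    integrable_indicator_norm_inv_pow_four (2 * ρ)
  set K := M * (2 * ρ) + 1
  refine IsBigO.of_bound ((105 : ℝ) ^ ((1 : ℝ) / 4) * K ^ 2 *
    ∫ x : EuclideanSpace ℝ (Fin 5), I ‖x‖) ?_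
  filter_upwards [self_mem_nhdsWithin] with ε hε
  have hε : 0 < ε := hε
  set A := (105 * ε ^ 2) ^ ((1 : ℝ) / 8) with hAdef
  have hA : 0 ≤ A := by positivity
  have hA2 : A ^ 2 = 105 ^ ((1 : ℝ) / 4) * ε ^ ((1 : ℝ) / 2) := by
    rw [hAdef, ← Real.rpow_natCast, ← Real.rpow_mul (by positivity),
      Real.mul_rpow (by norm_num) (by positivity), ← Real.rpow_natCast ε 2,
      ← Real.rpow_mul hε.le]
    norm_num
  rw [Real.norm_of_nonneg (integral_nonneg fun x => by positivity),
    Real.norm_of_nonneg (by positivity)]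
  have key : ∀ᵐ x : EuclideanSpace ℝ (Fin 5),
      ‖gradient (cutBubble 5 g ε) x‖ ^ 2 ≤ A ^ 2 * K ^ 2 * I ‖x‖ := by
    filter_upwards [Measure.ae_ne volume 0] with x hx
    have hr : 0 < ‖x‖ := norm_pos_iff.2 hx
    rw [cutBubble_five_eq]
    by_cases hxR : ‖x‖ ≤ 2 * ρ
    · have h := (norm_gradient_comp_norm_le hx (hasDerivAt_cutBubble_profile (A := A)
        (hdiff ‖x‖).hasDerivAt hε)).trans (abs_deriv_cutBubble_profile_le hr hxR hε hA
          (hM ‖x‖ ⟨hr.le, hxR⟩) (by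
            rw [abs_of_nonneg (hg01 _ hr.le).1]; exact (hg01 _ hr.le).2))
      rw [hI, Set.indicator_of_mem (Set.mem_Iic.2 hxR)]
      calc _ ≤ (A * K * (‖x‖ ^ 2)⁻¹) ^ 2 := by gcongr
        _ = _ := by field_simp
    · have hev : (fun t => g t * (A / √(ε + t ^ 2))) =ᶠ[𝓝 ‖x‖] fun _ => 0 := by
        filter_upwards [lt_mem_nhds (not_le.1 hxR)] with t ht
        rw [hg0 t ht.le, zero_mul]
      have h := norm_gradient_comp_norm_le hx
        ((hasDerivAt_const ‖x‖ (0 : ℝ)).congr_of_eventuallyEq hev)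
      rw [abs_zero, norm_le_zero_iff] at h
      rw [h, hI, Set.indicator_of_notMem (by simpa using hxR)]
      simp
  calc _ ≤ ∫ x : EuclideanSpace ℝ (Fin 5), A ^ 2 * K ^ 2 * I ‖x‖ :=
        integral_mono_of_nonneg (.of_forall fun x => by positivity) (hint.const_mul _) key
    _ = _ := by rw [integral_const_mul, hA2]; ring
end

section
/- Let N > 8. Then ∫_{ℝ^N} V_ε(x)² log(V_ε(x)²) dx = c_N (N−4)/2 · K₂ ε² log(1/ε) + O(ε²) as ε → 0⁺, where c_N = (N(N−4)(N²−4))^{(N−4)/4} and K₂ = ∫_{ℝ^N} (1+|y|²)^{−(N−4)} dy (finite since N > 8). Here the integrand is taken to be 0 at points where V_ε = 0. -/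
open MeasureTheory Real Filter Asymptotics
open scoped Topology

/-- The square of the truncated bubble in the rescaled variable `x = √ε y`. -/
lemma cutBubble_sq_sqrt_smul {N : ℕ} (hN : 4 < N) (g : ℝ → ℝ) {ε : ℝ} (hε : 0 < ε)
    (y : EuclideanSpace ℝ (Fin N)) :
    (cutBubble N g ε (√ε • y)) ^ 2 = g (√ε * ‖y‖) ^ 2 *
      (((N : ℝ) * ((N : ℝ) - 4) * ((N : ℝ) ^ 2 - 4)) ^ (((N : ℝ) - 4) / 4) *
        ε ^ (-(((N : ℝ) - 4) / 2)) * (1 + ‖y‖ ^ 2) ^ (-((N : ℝ) - 4))) := by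
  have hN' : (4 : ℝ) < N := by exact_mod_cast hN
  have hA : 0 < (N : ℝ) * ((N : ℝ) - 4) * ((N : ℝ) ^ 2 - 4) :=
    mul_pos (mul_pos (by linarith) (by linarith)) (by nlinarith)
  have ht : 0 < 1 + ‖y‖ ^ 2 := by positivity
  have hnorm : ‖√ε • y‖ = √ε * ‖y‖ := by
    rw [norm_smul, Real.norm_of_nonneg (Real.sqrt_nonneg ε)]
  have hden : ε + (√ε * ‖y‖) ^ 2 = ε * (1 + ‖y‖ ^ 2) := by
    rw [mul_pow, Real.sq_sqrt hε.le]; ring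
  unfold cutBubble bubble
  rw [hnorm, hden]
  generalize (N : ℝ) * ((N : ℝ) - 4) * ((N : ℝ) ^ 2 - 4) = A at hA
  generalize (N : ℝ) - 4 = p
  generalize 1 + ‖y‖ ^ 2 = t at ht
  rw [mul_pow, div_pow]
  congr 1
  have hsq : ∀ (x q : ℝ), 0 ≤ x → (x ^ q) ^ 2 = x ^ (q * 2) := fun x q hx => by
    rw [← Real.rpow_natCast, ← Real.rpow_mul hx]; norm_num
  rw [hsq _ _ (by positivity), hsq _ _ (by positivity), Real.mul_rpow hA.le (by positivity),
    Real.mul_rpow hε.le ht.le, ← Real.rpow_natCast ε 2, ← Real.rpow_mul hε.le, div_eq_mul_inv,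
    mul_inv, ← Real.rpow_neg hε.le, ← Real.rpow_neg ht.le, mul_mul_mul_comm, ← mul_assoc,
    mul_assoc (A ^ _) (ε ^ _) (ε ^ _)]
  rw [show p / 8 * 2 = p / 4 by ring, show p / 2 * 2 = p by ring]
  have : ε ^ (((2 : ℕ) : ℝ) * (p / 4)) * ε ^ (-p) = ε ^ (-(p / 2)) := by
    rw [← Real.rpow_add hε]; congr 1; push_cast; ring
  rw [← this]
  ring

/-- On `[0, 1]` one has `|x log x| ≤ 1`. -/
lemma abs_mul_log_le_one {x : ℝ} (h0 : 0 ≤ x) (h1 : x ≤ 1) : |x * Real.log x| ≤ 1 := by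
  rcases h0.eq_or_lt with rfl | h
  · simp
  · rw [mul_comm]; exact (Real.abs_log_mul_self_lt x h h1).le

lemma mul_log_mul_rpow_sub {c ε t p s : ℝ} (hc : 0 < c) (hε : 0 < ε) (ht : 0 < t) :
    s ^ 2 * (c * ε ^ (-(p / 2)) * t ^ (-p)) * Real.log (s ^ 2 * (c * ε ^ (-(p / 2)) * t ^ (-p)))
        - ε ^ (-(p / 2)) * c * (p / 2) * Real.log (1 / ε) * t ^ (-p) =
      ε ^ (-(p / 2)) * c * t ^ (-p) *
        ((s ^ 2 - 1) * Real.log (1 / ε) * (p / 2) + s ^ 2 * (Real.log c - p * Real.log t)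
          + s ^ 2 * Real.log (s ^ 2)) := by
  rcases eq_or_ne s 0 with rfl | hs
  · simp; ring
  · have h1 := Real.rpow_pos_of_pos hε (-(p / 2))
    have h2 := Real.rpow_pos_of_pos ht (-p)
    rw [Real.log_mul (by positivity) (by positivity), Real.log_mul (by positivity) h2.ne',
      Real.log_mul hc.ne' h1.ne', Real.log_rpow hε, Real.log_rpow ht, one_div, Real.log_inv]
    ring

/-- The error density is dominated, uniformly in `ε`, by a small power of `1 + |y|²`. -/
lemma abs_log_error_le {c ε r ρ p δ s : ℝ} (hε : 0 < ε) (hε1 : ε ≤ 1) (hρ : 0 < ρ)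
    (hp : 0 ≤ p) (hδ : 0 < δ) (hs0 : 0 ≤ s) (hs1 : s ≤ 1)
    (hs : √ε * r ≤ ρ → s = 1) :
    |(s ^ 2 - 1) * Real.log (1 / ε) * (p / 2) + s ^ 2 * (Real.log c - p * Real.log (1 + r ^ 2))
          + s ^ 2 * Real.log (s ^ 2)| ≤
      (((1 / ρ ^ 2) ^ δ / δ) * (p / 2) + (|Real.log c| + p / δ) + 1) * (1 + r ^ 2) ^ δ := by
  have ht : 1 ≤ 1 + r ^ 2 := by nlinarith
  have hs2 : s ^ 2 ≤ 1 := by nlinarith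
  have htδ : 1 ≤ (1 + r ^ 2) ^ δ := Real.one_le_rpow ht hδ.le
  have hL : 0 ≤ Real.log (1 / ε) := Real.log_nonneg (by rw [le_div_iff₀ hε]; linarith)
  have e1 : |(s ^ 2 - 1) * Real.log (1 / ε)| ≤ (1 / ρ ^ 2) ^ δ / δ * (1 + r ^ 2) ^ δ := by
    by_cases h : √ε * r ≤ ρ
    · rw [hs h]; simp; positivity
    · have hlt : ρ ^ 2 ≤ ε * r ^ 2 := by
        have := pow_le_pow_left₀ hρ.le (not_le.mp h).le 2
        rwa [mul_pow, Real.sq_sqrt hε.le] at this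
      have hle : 1 / ε ≤ 1 / ρ ^ 2 * (1 + r ^ 2) := by
        rw [div_mul_eq_mul_div, one_mul, div_le_div_iff₀ hε (by positivity)]
        nlinarith
      calc |(s ^ 2 - 1) * Real.log (1 / ε)| = (1 - s ^ 2) * Real.log (1 / ε) := by
            rw [abs_mul, abs_of_nonneg hL, abs_sub_comm, abs_of_nonneg (by linarith)]
        _ ≤ Real.log (1 / ε) := mul_le_of_le_one_left hL (by nlinarith)
        _ ≤ (1 / ε) ^ δ / δ := Real.log_le_rpow_div (by positivity) hδ
        _ ≤ (1 / ρ ^ 2 * (1 + r ^ 2)) ^ δ / δ := by gcongr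
        _ = _ := by rw [Real.mul_rpow (by positivity) (by positivity)]; ring
  have hlogt : Real.log (1 + r ^ 2) ≤ (1 + r ^ 2) ^ δ / δ :=
    Real.log_le_rpow_div (by positivity) hδ
  have e2 : |s ^ 2 * (Real.log c - p * Real.log (1 + r ^ 2))| ≤
      (|Real.log c| + p / δ) * (1 + r ^ 2) ^ δ := by
    rw [abs_mul, abs_of_nonneg (sq_nonneg s)]
    calc s ^ 2 * |Real.log c - p * Real.log (1 + r ^ 2)|
        ≤ |Real.log c - p * Real.log (1 + r ^ 2)| := mul_le_of_le_one_left (abs_nonneg _) hs2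
      _ ≤ |Real.log c| + |p * Real.log (1 + r ^ 2)| := abs_sub _ _
      _ = |Real.log c| * 1 + p * Real.log (1 + r ^ 2) := by
          rw [abs_of_nonneg (mul_nonneg hp (Real.log_nonneg ht)), mul_one]
      _ ≤ |Real.log c| * (1 + r ^ 2) ^ δ + p * ((1 + r ^ 2) ^ δ / δ) := by gcongr
      _ = _ := by ring
  have e3 := abs_mul_log_le_one (sq_nonneg s) hs2
  have e1' : |(s ^ 2 - 1) * Real.log (1 / ε) * (p / 2)| ≤
      (1 / ρ ^ 2) ^ δ / δ * (1 + r ^ 2) ^ δ * (p / 2) := by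
    rw [abs_mul, abs_of_nonneg (show 0 ≤ p / 2 by positivity)]
    gcongr
  refine (abs_add_three _ _ _).trans ?_
  nlinarith

/-- For `N > 8`:
`∫ V_ε² log(V_ε²) = c_N ((N−4)/2) K₂ ε² log(1/ε) + O(ε²)` as `ε → 0⁺`, where
`c_N = (N(N−4)(N²−4))^{(N−4)/4}` and `K₂ = ∫_{ℝ^N} (1+|y|²)^{−(N−4)} dy`.
(Here `Real.log 0 = 0`, so the integrand is `0` wherever `V_ε = 0`.) -/
theorem cutBubble_log_estimate_high_dim (N : ℕ) (hN : 8 < N) (ρ : ℝ) (hρ : 0 < ρ)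
    (g : ℝ → ℝ) (hg : ContDiff ℝ (⊤ : ℕ∞) g)
    (hg01 : ∀ r : ℝ, 0 ≤ r → g r ∈ Set.Icc (0 : ℝ) 1)
    (hg1 : ∀ r : ℝ, 0 ≤ r → r ≤ ρ → g r = 1)
    (hg0 : ∀ r : ℝ, 2 * ρ ≤ r → g r = 0)
    (cN K₂ : ℝ)
    (hcN : cN = ((N : ℝ) * ((N : ℝ) - 4) * ((N : ℝ) ^ 2 - 4)) ^ (((N : ℝ) - 4) / 4))
    (hK₂ : K₂ = ∫ y : EuclideanSpace ℝ (Fin N), (1 + ‖y‖ ^ 2) ^ (-((N : ℝ) - 4))) :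
    (fun ε : ℝ =>
        (∫ x : EuclideanSpace ℝ (Fin N),
            (cutBubble N g ε x) ^ 2 * Real.log ((cutBubble N g ε x) ^ 2))
          - cN * (((N : ℝ) - 4) / 2) * K₂ * ε ^ 2 * Real.log (1 / ε))
      =O[𝓝[>] (0 : ℝ)] (fun ε : ℝ => ε ^ 2) := by
  have hN' : (9 : ℝ) ≤ N := by exact_mod_cast hN
  set c := ((N : ℝ) * ((N : ℝ) - 4) * ((N : ℝ) ^ 2 - 4)) ^ (((N : ℝ) - 4) / 4) with hc_def
  have hc : 0 < c := Real.rpow_pos_of_pos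
    (mul_pos (mul_pos (by linarith) (by linarith)) (by nlinarith)) _
  subst hcN
  set p := (N : ℝ) - 4 with hp_def
  have hp : 0 ≤ p := by linarith
  set M := ((1 / ρ ^ 2) ^ (1 / 4 : ℝ) / (1 / 4)) * (p / 2)
    + (|Real.log c| + p / (1 / 4)) + 1
  have hfin : (Module.finrank ℝ (EuclideanSpace ℝ (Fin N)) : ℝ) = N := by simp
  have hint : ∀ q : ℝ, (N : ℝ) < 2 * q →
      Integrable (fun y : EuclideanSpace ℝ (Fin N) => (1 + ‖y‖ ^ 2) ^ (-q)) := fun q hq => by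
    have := integrable_rpow_neg_one_add_norm_sq
      (μ := (volume : Measure (EuclideanSpace ℝ (Fin N)))) (r := 2 * q) (by rwa [hfin])
    simpa only [show -(2 * q) / 2 = -q by ring] using this
  have hG := hint (p - 1 / 4) (by linarith)
  have hH := hint p (by linarith)
  set G := ∫ y : EuclideanSpace ℝ (Fin N), (1 + ‖y‖ ^ 2) ^ (-(p - 1 / 4))
  refine IsBigO.of_bound (c * (M * G)) ?_
  filter_upwards [Ioc_mem_nhdsGT (zero_lt_one' ℝ)] with ε hε
  obtain ⟨hε, hε1⟩ := hε
  set F : EuclideanSpace ℝ (Fin N) → ℝ := fun y =>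
    (cutBubble N g ε (√ε • y)) ^ 2 * Real.log ((cutBubble N g ε (√ε • y)) ^ 2)
  set P : EuclideanSpace ℝ (Fin N) → ℝ := fun y =>
    ε ^ (-(p / 2)) * c * (p / 2) * Real.log (1 / ε) * (1 + ‖y‖ ^ 2) ^ (-p)
  have hP : Integrable P := hH.const_mul _
  have hbound : ∀ y, ‖F y - P y‖ ≤
      ε ^ (-(p / 2)) * c * M * (1 + ‖y‖ ^ 2) ^ (-(p - 1 / 4)) := fun y => by
    have ht : 0 < 1 + ‖y‖ ^ 2 := by positivity
    have hr : 0 ≤ √ε * ‖y‖ := by positivity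
    simp only [F, P]
    rw [cutBubble_sq_sqrt_smul (by omega) g hε y, mul_log_mul_rpow_sub hc hε ht,
      Real.norm_eq_abs, abs_mul, abs_of_pos (by positivity),
      show -(p - 1 / 4) = -p + 1 / 4 by ring, Real.rpow_add ht]
    refine (mul_le_mul_of_nonneg_left (abs_log_error_le (δ := 1 / 4) hε hε1 hρ hp (by norm_num)
      (hg01 _ hr).1 (hg01 _ hr).2 (hg1 _ hr)) (by positivity)).trans_eq ?_
    ring
  have hgm : Measurable g := hg.continuous.measurable
  have hFm : Measurable F := by
    have : Measurable fun y : EuclideanSpace ℝ (Fin N) => cutBubble N g ε (√ε • y) := by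
      unfold cutBubble bubble
      fun_prop
    fun_prop
  have hFP : Integrable (fun y => F y - P y) :=
    Integrable.mono' (hG.const_mul (ε ^ (-(p / 2)) * c * M))
      (hFm.aestronglyMeasurable.sub hP.aestronglyMeasurable) (Eventually.of_forall hbound)
  have hF : Integrable F := (hFP.add hP).congr (Eventually.of_forall fun y => sub_add_cancel _ _)
  have hscale : ε ^ ((N : ℝ) / 2) * ε ^ (-(p / 2)) = ε ^ 2 := by
    rw [← Real.rpow_add hε, ← Real.rpow_natCast]
    congr 1
    push_cast
    ring
  have hchange : (∫ x : EuclideanSpace ℝ (Fin N),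
      (cutBubble N g ε x) ^ 2 * Real.log ((cutBubble N g ε x) ^ 2)) =
      ε ^ ((N : ℝ) / 2) * ∫ y, F y := by
    have hpow : (√ε) ^ N = ε ^ ((N : ℝ) / 2) := by
      rw [Real.sqrt_eq_rpow, ← Real.rpow_natCast, ← Real.rpow_mul hε.le]
      congr 1
      ring
    have h := Measure.integral_comp_smul (volume : Measure (EuclideanSpace ℝ (Fin N)))
      (fun x => (cutBubble N g ε x) ^ 2 * Real.log ((cutBubble N g ε x) ^ 2)) (√ε)
    have hpos : 0 < ε ^ ((N : ℝ) / 2) := by positivity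
    rw [finrank_euclideanSpace_fin, hpow, abs_of_pos (inv_pos.mpr hpos), smul_eq_mul] at h
    rw [show (∫ y, F y) = _ from h, mul_inv_cancel_left₀ hpos.ne']
  have hmain : c * (p / 2) * K₂ * ε ^ 2 * Real.log (1 / ε) = ε ^ ((N : ℝ) / 2) * ∫ y, P y := by
    simp only [P]
    rw [integral_const_mul, ← hK₂, ← hscale]
    ring
  rw [hchange, hmain, ← mul_sub, ← integral_sub hF hP, norm_mul,
    Real.norm_of_nonneg (by positivity), Real.norm_of_nonneg (sq_nonneg ε)]
  calc ε ^ ((N : ℝ) / 2) * ‖∫ y, (F y - P y)‖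
      ≤ ε ^ ((N : ℝ) / 2) * ∫ y : EuclideanSpace ℝ (Fin N),
          ε ^ (-(p / 2)) * c * M * (1 + ‖y‖ ^ 2) ^ (-(p - 1 / 4)) := by
        gcongr
        exact norm_integral_le_of_norm_le (hG.const_mul _) (Eventually.of_forall hbound)
    _ = c * (M * G) * ε ^ 2 := by
        rw [integral_const_mul, ← hscale]
        ring
end

section
/- Let N = 8. Then there exist constants C > 0 and ε₀ > 0 such that for all ε ∈ (0, ε₀), ∫_{ℝ^8} V_ε(x)² log(V_ε(x)²) dx ≥ c₈ ω₈ log( √c₈ (ε+ρ²) / ( e^{11/6} (ε+4ρ²)² ) ) · ε² log(1/ε) − C ε², where c₈ = (8(8−4)(8²−4))^{(8−4)/4} and ω₈ is the surface area of the unit sphere in ℝ⁸. -/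
open MeasureTheory Real Filter Asymptotics
open scoped Topology

theorem sq_bubble_eight {ε : ℝ} (hε : 0 < ε) (x : EuclideanSpace ℝ (Fin 8)) :
    bubble 8 ε x ^ 2 = 1920 * ε ^ 2 / (ε + ‖x‖ ^ 2) ^ 4 := by
  have h1 : (((8 : ℕ) : ℝ) - 4) / 8 = 1 / 2 := by norm_num
  have h2 : (((8 : ℕ) : ℝ) - 4) / 2 = 2 := by norm_num
  have h3 : ((8 : ℕ) : ℝ) * (((8 : ℕ) : ℝ) - 4) * (((8 : ℕ) : ℝ) ^ 2 - 4) * ε ^ 2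
      = 1920 * ε ^ 2 := by norm_num
  rw [bubble, h1, h2, h3, ← Real.sqrt_eq_rpow, Real.rpow_two, div_pow,
    Real.sq_sqrt (by positivity), ← pow_mul]

/-- The square of the truncated bubble in dimension `8`, as a function of the radius. -/
noncomputable def sqCutProfile (g : ℝ → ℝ) (ε r : ℝ) : ℝ :=
  g r ^ 2 * (1920 * ε ^ 2 / (ε + r ^ 2) ^ 4)

theorem sq_cutBubble_eight (g : ℝ → ℝ) {ε : ℝ} (hε : 0 < ε) (x : EuclideanSpace ℝ (Fin 8)) :
    cutBubble 8 g ε x ^ 2 = sqCutProfile g ε ‖x‖ := by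
  rw [cutBubble, mul_pow, sq_bubble_eight hε, sqCutProfile]

theorem continuous_sqCutProfile {g : ℝ → ℝ} (hg : Continuous g) {ε : ℝ} (hε : 0 < ε) :
    Continuous (sqCutProfile g ε) := by
  unfold sqCutProfile
  refine (hg.pow 2).mul (Continuous.div (by fun_prop) (by fun_prop) fun r => ?_)
  positivity

theorem integral_fun_norm_eight (f : ℝ → ℝ) :
    ∫ x : EuclideanSpace ℝ (Fin 8), f ‖x‖
      = sphereArea 8 * ∫ r in Set.Ioi (0 : ℝ), r ^ 7 * f r := by
  rw [integral_fun_norm_addHaar volume f]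
  simp [sphereArea, Measure.real, mul_assoc]

/-- Primitive of `w ↦ (w - ε) ^ 3 / w ^ 4 * (a - 4 * log w)`. -/
theorem hasDerivAt_bubble_primitive (a ε : ℝ) {w : ℝ} (hw : 0 < w) :
    HasDerivAt (fun w : ℝ =>
      a * (log w + 3 * ε / w - 3 * ε ^ 2 / (2 * w ^ 2) + ε ^ 3 / (3 * w ^ 3))
      - 4 * (log w ^ 2 / 2 + 3 * ε * (log w + 1) / w
        - 3 * ε ^ 2 * (2 * log w + 1) / (4 * w ^ 2) + ε ^ 3 * (3 * log w + 1) / (9 * w ^ 3)))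
      ((w - ε) ^ 3 / w ^ 4 * (a - 4 * log w)) w := by
  have hw' : w ≠ 0 := hw.ne'
  have hl := Real.hasDerivAt_log hw'
  have hi := hasDerivAt_id' w
  have hw2 : (2 : ℝ) * w ^ 2 ≠ 0 := by positivity
  have hw3 : (3 : ℝ) * w ^ 3 ≠ 0 := by positivity
  have hw4 : (4 : ℝ) * w ^ 2 ≠ 0 := by positivity
  have hw9 : (9 : ℝ) * w ^ 3 ≠ 0 := by positivity
  have h1 : HasDerivAt (fun w : ℝ => 3 * ε / w) (-(3 * ε) / w ^ 2) w :=
    ((hasDerivAt_const w (3 * ε)).div hi hw').congr_deriv (by ring)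
  have h2 : HasDerivAt (fun w : ℝ => 3 * ε ^ 2 / (2 * w ^ 2)) (-(3 * ε ^ 2) / w ^ 3) w :=
    ((hasDerivAt_const w (3 * ε ^ 2)).div ((hi.pow 2).const_mul 2) hw2).congr_deriv
      (by simp; field_simp)
  have h3 : HasDerivAt (fun w : ℝ => ε ^ 3 / (3 * w ^ 3)) (-(ε ^ 3) / w ^ 4) w :=
    ((hasDerivAt_const w (ε ^ 3)).div ((hi.pow 3).const_mul 3) hw3).congr_deriv
      (by simp; field_simp)
  have k0 : HasDerivAt (fun w : ℝ => log w ^ 2 / 2) (log w / w) w :=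
    ((hl.pow 2).div_const 2).congr_deriv (by simp; field_simp)
  have k1 : HasDerivAt (fun w : ℝ => 3 * ε * (log w + 1) / w) (-(3 * ε * log w) / w ^ 2) w :=
    (((hl.add_const 1).const_mul (3 * ε)).div hi hw').congr_deriv (by field_simp; ring)
  have k2 : HasDerivAt (fun w : ℝ => 3 * ε ^ 2 * (2 * log w + 1) / (4 * w ^ 2))
      (-(3 * ε ^ 2 * log w) / w ^ 3) w :=
    ((((hl.const_mul 2).add_const 1).const_mul (3 * ε ^ 2)).div
      ((hi.pow 2).const_mul 4) hw4).congr_deriv (by simp; field_simp; ring)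
  have k3 : HasDerivAt (fun w : ℝ => ε ^ 3 * (3 * log w + 1) / (9 * w ^ 3))
      (-(ε ^ 3 * log w) / w ^ 4) w :=
    ((((hl.const_mul 3).add_const 1).const_mul (ε ^ 3)).div
      ((hi.pow 3).const_mul 9) hw9).congr_deriv (by simp; field_simp; ring)
  exact (((((hl.add h1).sub h2).add h3).const_mul a).sub
    ((((k0.add k1).sub k2).add k3).const_mul 4)).congr_deriv (by field_simp; ring)

theorem log_sq_bubble {ε w : ℝ} (hε : 0 < ε) (hw : 0 < w) :
    log (1920 * ε ^ 2 / w ^ 4) = log 1920 + 2 * log ε - 4 * log w := by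
  rw [log_div (by positivity) (by positivity), log_mul (by positivity) (by positivity),
    log_pow, log_pow]
  norm_num

theorem integral_bubble_log (ρ : ℝ) {ε : ℝ} (hε : 0 < ε) :
    ∫ r in (0 : ℝ)..ρ, r ^ 7 * (1920 * ε ^ 2 / (ε + r ^ 2) ^ 4
        * log (1920 * ε ^ 2 / (ε + r ^ 2) ^ 4))
      = 960 * ε ^ 2 *
        ((log 1920 + 2 * log ε) * (log (ε + ρ ^ 2) + 3 * (ε / (ε + ρ ^ 2))
            - 3 / 2 * (ε / (ε + ρ ^ 2)) ^ 2 + (ε / (ε + ρ ^ 2)) ^ 3 / 3 - log ε - 11 / 6)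
          - 4 * (log (ε + ρ ^ 2) ^ 2 / 2 + 3 * (ε / (ε + ρ ^ 2)) * (log (ε + ρ ^ 2) + 1)
            - 3 / 4 * (ε / (ε + ρ ^ 2)) ^ 2 * (2 * log (ε + ρ ^ 2) + 1)
            + (ε / (ε + ρ ^ 2)) ^ 3 * (3 * log (ε + ρ ^ 2) + 1) / 9
            - log ε ^ 2 / 2 - 11 / 6 * log ε - 85 / 36)) := by
  have hw : ∀ r : ℝ, 0 < ε + r ^ 2 := fun r => by positivity
  have hd : ∀ r ∈ Set.uIcc 0 ρ, HasDerivAt _ _ r := fun r _ =>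
    (((hasDerivAt_bubble_primitive (log 1920 + 2 * log ε) ε (hw r)).comp r
      (((hasDerivAt_id' r).pow 2).const_add ε)).const_mul (960 * ε ^ 2))
  have hcongr : ∀ r : ℝ, r ^ 7 * (1920 * ε ^ 2 / (ε + r ^ 2) ^ 4
        * log (1920 * ε ^ 2 / (ε + r ^ 2) ^ 4)) =
      960 * ε ^ 2 * (((ε + r ^ 2 - ε) ^ 3 / (ε + r ^ 2) ^ 4 *
        (log 1920 + 2 * log ε - 4 * log (ε + r ^ 2))) * (((2 : ℕ) : ℝ) * r ^ (2 - 1) * 1)) := by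
    intro r
    rw [log_sq_bubble hε (hw r)]
    have := (hw r).ne'
    push_cast
    field_simp
    ring
  simp_rw [hcongr]
  rw [intervalIntegral.integral_eq_sub_of_hasDerivAt hd]
  · have := (hw ρ).ne'
    simp only [Function.comp, Pi.pow_apply]
    generalize log (ε + ρ ^ 2) = W
    rw [show ε + (0 : ℝ) ^ 2 = ε by ring]
    generalize log ε = l at *
    field_simp
    ring
  · refine Continuous.intervalIntegrable ?_ _ _
    refine continuous_const.mul (Continuous.mul (Continuous.mul ?_ ?_) (by fun_prop))
    · exact Continuous.div (by fun_prop) (by fun_prop) fun r => pow_ne_zero _ (hw r).ne'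
    · exact continuous_const.sub (continuous_const.mul
        (Continuous.log (by fun_prop) fun r => (hw r).ne'))

theorem mul_log_mul_ge {p q m : ℝ} (hp : p ∈ Set.Icc (0 : ℝ) 1) (hq : 0 < q)
    (hm : m ≤ 0) (hmq : m ≤ log q) : q * (m - 1) ≤ p * q * log (p * q) := by
  obtain ⟨hp0, hp1⟩ := hp
  have hpm : -1 ≤ p * log p := by
    rcases hp0.eq_or_lt with rfl | hp0
    · simp
    have := mul_le_mul_of_nonneg_left (one_sub_inv_le_log_of_pos hp0) hp0.le
    rw [mul_sub, mul_inv_cancel₀ hp0.ne'] at this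
    linarith
  have hpq : m ≤ p * log q :=
    calc m ≤ p * m := by nlinarith
      _ ≤ p * log q := by gcongr
  have : p * q * log (p * q) = q * (p * log p + p * log q) := by
    rcases hp0.eq_or_lt with rfl | hp0
    · simp
    rw [log_mul hp0.ne' hq.ne']; ring
  rw [this]
  gcongr
  linarith

theorem integral_annulus_ge {ρ ε : ℝ} (hρ : 0 < ρ) (hε : 0 < ε) (hε1 : ε ≤ 1)
    {g : ℝ → ℝ} (hg : Continuous g) (hg01 : ∀ r : ℝ, 0 ≤ r → g r ∈ Set.Icc (0 : ℝ) 1) :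
    1920 * ε ^ 2 * (2 * log ε - 4 * log (1 + 4 * ρ ^ 2) - 1) * log 2
      ≤ ∫ r in ρ..2 * ρ, r ^ 7 * (sqCutProfile g ε r * log (sqCutProfile g ε r)) := by
  set m := 2 * log ε - 4 * log (1 + 4 * ρ ^ 2) with hmdef
  have hl : log ε ≤ 0 := log_nonpos hε.le hε1
  have hM : 0 ≤ log (1 + 4 * ρ ^ 2) := log_nonneg (by nlinarith [sq_nonneg ρ])
  have hm : m ≤ 0 := by linarith
  have hint : ∫ r in ρ..2 * ρ, 1920 * ε ^ 2 * (m - 1) * r⁻¹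
      = 1920 * ε ^ 2 * (m - 1) * log 2 := by
    rw [intervalIntegral.integral_const_mul, integral_inv_of_pos hρ (by positivity),
      mul_div_cancel_right₀ _ hρ.ne']
  rw [← hint]
  refine intervalIntegral.integral_mono_on (by linarith) ?_ ?_ ?_
  · refine (intervalIntegral.intervalIntegrable_inv (fun r hr => ?_) continuousOn_id).const_mul _
    rw [Set.uIcc_of_le (by linarith)] at hr
    exact (hρ.trans_le hr.1).ne'
  · exact ((continuous_pow 7).mul
      (Real.continuous_mul_log.comp (continuous_sqCutProfile hg hε))).intervalIntegrable _ _
  · intro r hr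
    have hr0 : 0 < r := hρ.trans_le hr.1
    have hw : 0 < ε + r ^ 2 := by positivity
    have hwle : ε + r ^ 2 ≤ 1 + 4 * ρ ^ 2 := by nlinarith [hr.1, hr.2]
    have hlogq : m ≤ log (1920 * ε ^ 2 / (ε + r ^ 2) ^ 4) := by
      rw [log_sq_bubble hε hw, hmdef]
      have h1 : log (ε + r ^ 2) ≤ log (1 + 4 * ρ ^ 2) := log_le_log hw hwle
      have h2 : 0 ≤ log (1920 : ℝ) := log_nonneg (by norm_num)
      linarith
    obtain ⟨hg0, hg1⟩ := hg01 r hr0.le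
    have key := mul_log_mul_ge (p := g r ^ 2) ⟨by positivity, pow_le_one₀ hg0 hg1⟩
      (show 0 < 1920 * ε ^ 2 / (ε + r ^ 2) ^ 4 by positivity) hm hlogq
    have hq : r ^ 7 * (1920 * ε ^ 2 / (ε + r ^ 2) ^ 4) ≤ 1920 * ε ^ 2 * r⁻¹ := by
      calc r ^ 7 * (1920 * ε ^ 2 / (ε + r ^ 2) ^ 4)
          ≤ r ^ 7 * (1920 * ε ^ 2 / (r ^ 2) ^ 4) := by gcongr; linarith
        _ = 1920 * ε ^ 2 * r⁻¹ := by field_simp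
    calc 1920 * ε ^ 2 * (m - 1) * r⁻¹ = 1920 * ε ^ 2 * r⁻¹ * (m - 1) := by ring
      _ ≤ r ^ 7 * (1920 * ε ^ 2 / (ε + r ^ 2) ^ 4) * (m - 1) :=
          mul_le_mul_of_nonpos_right hq (by linarith)
      _ = r ^ 7 * (1920 * ε ^ 2 / (ε + r ^ 2) ^ 4 * (m - 1)) := by ring
      _ ≤ _ := by
          unfold sqCutProfile
          gcongr

theorem integral_radial_split {ρ ε : ℝ} (hρ : 0 < ρ) (hε : 0 < ε) {g : ℝ → ℝ}
    (hg : Continuous g) (hg1 : ∀ r : ℝ, 0 ≤ r → r ≤ ρ → g r = 1)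
    (hg0 : ∀ r : ℝ, 2 * ρ ≤ r → g r = 0) :
    ∫ r in Set.Ioi (0 : ℝ), r ^ 7 * (sqCutProfile g ε r * log (sqCutProfile g ε r))
      = (∫ r in (0 : ℝ)..ρ, r ^ 7 * (1920 * ε ^ 2 / (ε + r ^ 2) ^ 4
          * log (1920 * ε ^ 2 / (ε + r ^ 2) ^ 4)))
        + ∫ r in ρ..2 * ρ, r ^ 7 * (sqCutProfile g ε r * log (sqCutProfile g ε r)) := by
  have hc : Continuous fun r : ℝ =>
      r ^ 7 * (sqCutProfile g ε r * log (sqCutProfile g ε r)) :=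
    (continuous_pow 7).mul (Real.continuous_mul_log.comp (continuous_sqCutProfile hg hε))
  have h1 : ∫ r in (0 : ℝ)..ρ, r ^ 7 * (1920 * ε ^ 2 / (ε + r ^ 2) ^ 4
        * log (1920 * ε ^ 2 / (ε + r ^ 2) ^ 4))
      = ∫ r in (0 : ℝ)..ρ, r ^ 7 * (sqCutProfile g ε r * log (sqCutProfile g ε r)) := by
    refine intervalIntegral.integral_congr fun r hr => ?_
    rw [Set.uIcc_of_le hρ.le] at hr
    simp [sqCutProfile, hg1 r hr.1 hr.2]
  rw [h1, intervalIntegral.integral_add_adjacent_intervals (hc.intervalIntegrable _ _)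
    (hc.intervalIntegrable _ _), intervalIntegral.integral_of_le (by positivity)]
  refine setIntegral_eq_of_subset_of_forall_sdiff_eq_zero measurableSet_Ioi
    Set.Ioc_subset_Ioi_self fun r hr => ?_
  have : 2 * ρ ≤ r := by
    by_contra! h
    exact hr.2 ⟨hr.1, h.le⟩
  simp [sqCutProfile, hg0 r this]

theorem abs_log_add_sq_le {ρ ε : ℝ} (hρ : 0 < ρ) (hε : 0 < ε) (hε1 : ε ≤ 1) :
    |log (ε + ρ ^ 2)| ≤ |log (ρ ^ 2)| + |log (1 + ρ ^ 2)| := by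
  have h1 : log (ρ ^ 2) ≤ log (ε + ρ ^ 2) := log_le_log (by positivity) (by linarith)
  have h2 : log (ε + ρ ^ 2) ≤ log (1 + ρ ^ 2) := log_le_log (by positivity) (by linarith)
  rw [abs_le]
  constructor
  · linarith [neg_abs_le (log (ρ ^ 2)), abs_nonneg (log (1 + ρ ^ 2))]
  · linarith [le_abs_self (log (1 + ρ ^ 2)), abs_nonneg (log (ρ ^ 2))]

/-- Lower bound for the explicit value of the integral of `u_ε² log u_ε²` on a ball, with
`l = log ε`, `W = log (ε + ρ²)` and `y = ε / (ε + ρ²)`. -/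
theorem ball_value_ge {a l W y K D : ℝ} (ha : 0 ≤ a) (hy0 : 0 ≤ y) (hy1 : y ≤ 1)
    (hW : |W| ≤ K) (hly : -D ≤ l * y) (hl : l ≤ 0) :
    -l * (a - 2 * W - 11 / 3) - (a * (K + 2) + 8 * D + 4 * (K ^ 2 + 4 * K + 4))
      ≤ (a + 2 * l) * (W + 3 * y - 3 / 2 * y ^ 2 + y ^ 3 / 3 - l - 11 / 6)
        - 4 * (W ^ 2 / 2 + 3 * y * (W + 1) - 3 / 4 * y ^ 2 * (2 * W + 1)
          + y ^ 3 * (3 * W + 1) / 9 - l ^ 2 / 2 - 11 / 6 * l - 85 / 36) := by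
  obtain ⟨hW1, hW2⟩ := abs_le.mp hW
  have hK : 0 ≤ K := (abs_nonneg W).trans hW
  have hy2 : y ^ 2 ≤ y := by nlinarith
  have hy3 : y ^ 3 ≤ y := by nlinarith [pow_nonneg hy0 2]
  have hy2' : 0 ≤ y ^ 2 := by positivity
  have hy3' : 0 ≤ y ^ 3 := by positivity
  set d := 3 * y - 3 / 2 * y ^ 2 + y ^ 3 / 3 with hd
  have hd0 : 0 ≤ d := by linarith
  have hd4 : d ≤ 4 * y := by linarith
  have e1 : -(a * (K + 2)) ≤ a * (W + d - 11 / 6) := by nlinarith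
  have e2 : -(8 * D) ≤ 2 * (l * d) := by nlinarith
  have e3 : W ^ 2 ≤ K ^ 2 := by nlinarith
  have e4 : W * d ≤ 4 * K := by nlinarith
  have e5 : 3 * y - 3 / 4 * y ^ 2 + y ^ 3 / 9 ≤ 4 := by linarith
  have e6 : 0 ≤ K ^ 2 := by positivity
  have : (a + 2 * l) * (W + 3 * y - 3 / 2 * y ^ 2 + y ^ 3 / 3 - l - 11 / 6)
        - 4 * (W ^ 2 / 2 + 3 * y * (W + 1) - 3 / 4 * y ^ 2 * (2 * W + 1)
          + y ^ 3 * (3 * W + 1) / 9 - l ^ 2 / 2 - 11 / 6 * l - 85 / 36)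
      = -l * (a - 2 * W - 11 / 3) + a * (W + d - 11 / 6) + 2 * (l * d)
        - 4 * (W ^ 2 / 2 + W * d + (3 * y - 3 / 4 * y ^ 2 + y ^ 3 / 9)) + 85 / 9 := by
    rw [hd]; ring
  rw [this]
  linarith

/-- For `N = 8`: there are `C > 0` and `ε₀ > 0` such that for `0 < ε < ε₀`,
`∫ V_ε² log(V_ε²) ≥ c₈ ω₈ log(√c₈ (ε+ρ²) / (e^{11/6} (ε+4ρ²)²)) ε² log(1/ε) − C ε²`,
where `c₈ = (8(8−4)(8²−4))^{(8−4)/4}` and `ω₈` is the area of the unit sphere in `ℝ⁸`.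
(Here `Real.log 0 = 0`, so the integrand is `0` wherever `V_ε = 0`.) -/
theorem cutBubble_log_lower_bound_dim8 (ρ : ℝ) (hρ : 0 < ρ)
    (g : ℝ → ℝ) (hg : ContDiff ℝ (⊤ : ℕ∞) g)
    (hg01 : ∀ r : ℝ, 0 ≤ r → g r ∈ Set.Icc (0 : ℝ) 1)
    (hg1 : ∀ r : ℝ, 0 ≤ r → r ≤ ρ → g r = 1)
    (hg0 : ∀ r : ℝ, 2 * ρ ≤ r → g r = 0)
    (c₈ : ℝ)
    (hc₈ : c₈ = ((8 : ℝ) * ((8 : ℝ) - 4) * ((8 : ℝ) ^ 2 - 4)) ^ (((8 : ℝ) - 4) / 4)) :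
    ∃ C : ℝ, 0 < C ∧ ∃ ε₀ : ℝ, 0 < ε₀ ∧ ∀ ε : ℝ, 0 < ε → ε < ε₀ →
      c₈ * sphereArea 8
          * Real.log (Real.sqrt c₈ * (ε + ρ ^ 2)
              / (Real.exp (11 / 6) * (ε + 4 * ρ ^ 2) ^ 2))
          * ε ^ 2 * Real.log (1 / ε) - C * ε ^ 2
        ≤ ∫ x : EuclideanSpace ℝ (Fin 8),
            (cutBubble 8 g ε x) ^ 2 * Real.log ((cutBubble 8 g ε x) ^ 2) := by
  have hc : c₈ = 1920 := by
    rw [hc₈, show ((8 : ℝ) - 4) / 4 = 1 by norm_num, Real.rpow_one]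
    norm_num
  subst hc
  clear hc₈
  have hS : 0 ≤ sphereArea 8 := by unfold sphereArea; positivity
  have ha : 0 ≤ log (1920 : ℝ) := log_nonneg (by norm_num)
  have hM : 0 ≤ log (1 + 4 * ρ ^ 2) := log_nonneg (by nlinarith [sq_nonneg ρ])
  have h2 : 0 ≤ log (2 : ℝ) := log_nonneg (by norm_num)
  set K := |log (ρ ^ 2)| + |log (1 + ρ ^ 2)| with hK
  have hK0 : 0 ≤ K := by positivity
  set E := (log 1920 * (K + 2) + 8 * (ρ ^ 2)⁻¹ + 4 * (K ^ 2 + 4 * K + 4)) / 2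
    + (4 * log (1 + 4 * ρ ^ 2) + 1) * log 2 with hE
  have hE0 : 0 ≤ E := by positivity
  refine ⟨1920 * sphereArea 8 * E + 1, by positivity, min 1 (2 * ρ ^ 2), by positivity, ?_⟩
  intro ε hε hεlt
  have hε1 : ε ≤ 1 := (hεlt.trans_le (min_le_left _ _)).le
  have hε2 : ε ≤ 2 * ρ ^ 2 := (hεlt.trans_le (min_le_right _ _)).le
  have hl : log ε ≤ 0 := log_nonpos hε.le hε1
  have hP : 0 < ε + ρ ^ 2 := by positivity
  have hQ : 0 < ε + 4 * ρ ^ 2 := by positivity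
  have hly : -(ρ ^ 2)⁻¹ ≤ log ε * (ε / (ε + ρ ^ 2)) := by
    have h : -1 ≤ ε * log ε := by
      have := mul_le_mul_of_nonneg_left (one_sub_inv_le_log_of_pos hε) hε.le
      rw [mul_sub, mul_inv_cancel₀ hε.ne'] at this
      linarith
    calc -(ρ ^ 2)⁻¹ ≤ -(ε + ρ ^ 2)⁻¹ := by
          gcongr
          linarith
      _ = -1 * (ε + ρ ^ 2)⁻¹ := by ring
      _ ≤ ε * log ε * (ε + ρ ^ 2)⁻¹ := by gcongr
      _ = log ε * (ε / (ε + ρ ^ 2)) := by ring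
  have hball := ball_value_ge ha (y := ε / (ε + ρ ^ 2)) (by positivity)
    ((div_le_one hP).mpr (by nlinarith [sq_nonneg ρ])) (abs_log_add_sq_le hρ hε hε1) hly hl
  have hann := integral_annulus_ge hρ hε hε1 hg.continuous hg01
  have hslack : log 2 ≤ log (ε + 4 * ρ ^ 2) - log (ε + ρ ^ 2) := by
    rw [← log_div hQ.ne' hP.ne']
    refine log_le_log (by norm_num) ((le_div_iff₀ hP).mpr ?_)
    linarith
  have htarget : log (√1920 * (ε + ρ ^ 2) / (exp (11 / 6) * (ε + 4 * ρ ^ 2) ^ 2))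
      = log 1920 / 2 + log (ε + ρ ^ 2) - 11 / 6 - 2 * log (ε + 4 * ρ ^ 2) := by
    rw [log_div (by positivity) (by positivity), log_mul (by positivity) hP.ne',
      log_mul (by positivity) (by positivity), log_exp, log_pow, log_sqrt (by norm_num)]
    push_cast
    ring
  simp_rw [sq_cutBubble_eight g hε]
  rw [integral_fun_norm_eight (fun r => sqCutProfile g ε r * log (sqCutProfile g ε r)),
    integral_radial_split hρ hε hg.continuous hg1 hg0, integral_bubble_log ρ hε, htarget,
    one_div, log_inv]
  have hprod : 0 ≤ -log ε * (log (ε + 4 * ρ ^ 2) - log (ε + ρ ^ 2) - log 2) :=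
    mul_nonneg (by linarith) (by linarith)
  refine le_trans (b := sphereArea 8 * (1920 * ε ^ 2 * ((log 1920 / 2 + log (ε + ρ ^ 2)
      - 11 / 6 - 2 * log (ε + 4 * ρ ^ 2)) * -log ε - E))) ?_
    (mul_le_mul_of_nonneg_left (le_trans ?_
      (add_le_add (mul_le_mul_of_nonneg_left hball (by positivity)) hann)) hS)
  · rw [← sub_nonneg]
    exact le_of_le_of_eq (sq_nonneg ε) (by ring)
  · rw [hE, ← sub_nonneg]
    refine le_of_le_of_eq (show 0 ≤ 3840 * ε ^ 2 *
      (-log ε * (log (ε + 4 * ρ ^ 2) - log (ε + ρ ^ 2) - log 2)) by positivity) ?_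
    rw [hK]
    ring
end
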